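/- arXiv:1601.03361 — 3 statements merged into one kernel-verified Lean document; each statement's English description precedes it below -/
import Mathlib

section
/- Let G be a locally finite Borel graph on a standard Borel space X, let B ⊆ X be Borel, and suppose f : B → X is a one-ended Borel function whose graph is contained in G. Let Y be a Polish space and let L : B → [Y]^{<∞} be a Borel function such that |L(x)| ≥ deg_G(x) for every x ∈ B, where deg_G(x) is the degree of x in G. Then the restriction of G to B admits a Borel coloring from the lists L, i.e. a Borel map c : B → Y with c(x) ∈ L(x) for all x ∈ B and c(x) ≠ c(y) whenever x, y ∈ B are adjacent in G. -/
open MeasureTheory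

/-- A partial function `f : B → X` is *one-ended* if there is no infinite sequence
`x₀, x₁, x₂, …` of points of `B` with `f (x_{i+1}) = x_i` for all `i`. -/
def OneEnded {X : Type*} {B : Set X} (f : B → X) : Prop :=
  ¬ ∃ u : ℕ → B, ∀ i : ℕ, f (u (i + 1)) = (u i : X)

/-- A set of vertices is `G`-invariant if it is a union of connected components of `G`. -/
def GraphInvariant {X : Type*} (G : SimpleGraph X) (A : Set X) : Prop :=
  ∀ ⦃x y : X⦄, G.Reachable x y → x ∈ A → y ∈ A

/-- `[A]_{E_G}`: the union of all connected components of `G` meeting `A`. -/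
def EGSat {X : Type*} (G : SimpleGraph X) (A : Set X) : Set X :=
  {x | ∃ a ∈ A, G.Reachable x a}

/-- `S` is biconnected: the induced subgraph on `S` is connected and remains connected
(in the sense of `Preconnected`) after deleting any single vertex of `S`. -/
def BiconnectedSet {X : Type*} (G : SimpleGraph X) (S : Set X) : Prop :=
  (G.induce S).Connected ∧ ∀ x ∈ S, (G.induce (S \ {x})).Preconnected

/-- A block of `G` is a maximal biconnected set. -/
def GraphBlock {X : Type*} (G : SimpleGraph X) (S : Set X) : Prop :=
  BiconnectedSet G S ∧ ∀ T : Set X, BiconnectedSet G T → S ⊆ T → T = S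

/-- The induced subgraph on `S` is a cycle of odd length. -/
def OddCycleSet {X : Type*} (G : SimpleGraph X) (S : Set X) : Prop :=
  ∃ n : ℕ, Odd n ∧ 3 ≤ n ∧ Nonempty (G.induce S ≃g SimpleGraph.cycleGraph n)

/-- A Gallai tree is a connected graph each of whose blocks induces a complete
graph or an odd cycle. -/
def GallaiTree {X : Type*} (G : SimpleGraph X) : Prop :=
  G.Connected ∧ ∀ S : Set X, GraphBlock G S → G.IsClique S ∨ OddCycleSet G S

/-- A graph is ample if every vertex has degree at least 2 and for every vertex `x`,
every connected component of the restriction of `G` to the complement of `{x}`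
contains a vertex of degree at least 3 in that restriction. -/
def AmpleGraph {X : Type*} (G : SimpleGraph X) : Prop :=
  (∀ x : X, 2 ≤ (G.neighborSet x).encard) ∧
  ∀ x : X, ∀ y : ({x}ᶜ : Set X), ∃ z : ({x}ᶜ : Set X),
    (G.induce ({x}ᶜ : Set X)).Reachable y z ∧
      3 ≤ ((G.induce ({x}ᶜ : Set X)).neighborSet z).encard

/-- `x E^even_G y`: `x` and `y` are joined by a path of even length in `G`. -/
def EvenRel {X : Type*} (G : SimpleGraph X) (x y : X) : Prop :=
  ∃ p : G.Walk x y, p.IsPath ∧ Even p.length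

/-- A set is `E^even_G`-invariant if it is a union of `E^even_G`-classes. -/
def EvenInvariant {X : Type*} (G : SimpleGraph X) (C : Set X) : Prop :=
  ∀ ⦃x y : X⦄, EvenRel G x y → x ∈ C → y ∈ C


/-- **Bar induction** on finite sequences of natural numbers. -/
theorem bar_induction {Q : List ℕ → Prop} (step : ∀ s, (∀ i, Q (s ++ [i])) → Q s)
    (bar : ∀ z : ℕ → ℕ, ∃ k, Q ((List.range k).map z)) : Q [] := by
  by_contra h0
  have hext : ∀ s, ∃ i, ¬ Q s → ¬ Q (s ++ [i]) := by
    intro s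
    by_cases hs : Q s
    · exact ⟨0, fun h => absurd hs h⟩
    · obtain ⟨i, hi⟩ := not_forall.1 (mt (step s) hs)
      exact ⟨i, fun _ => hi⟩
  choose e he using hext
  let t : ℕ → List ℕ := fun k => k.rec [] (fun _ s => s ++ [e s])
  have ht : ∀ k, ¬ Q (t k) := by
    intro k
    induction k with
    | zero => exact h0
    | succ k ih => exact he _ ih
  obtain ⟨k, hk⟩ := bar fun k => e (t k)
  have hmap : ∀ k, (List.range k).map (fun k => e (t k)) = t k := by
    intro k
    induction k with
    | zero => rfl
    | succ k ih => rw [List.range_succ, List.map_append, ih]; rfl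
  exact ht k (hmap k ▸ hk)

/-- The **Novikov separation theorem** for continuous images of the Baire space. -/
theorem exists_measurableSet_superset_iInter_eq_empty_of_continuous {α : Type*}
    [TopologicalSpace α] [T2Space α] [MeasurableSpace α] [OpensMeasurableSpace α]
    {f : ℕ → (ℕ → ℕ) → α} (hf : ∀ n, Continuous (f n)) (h : ⋂ n, Set.range (f n) = ∅) :
    ∃ S : ℕ → Set α, (∀ n, MeasurableSet (S n)) ∧ (∀ n, Set.range (f n) ⊆ S n) ∧
      ⋂ n, S n = ∅ := by
  let F : ℕ → (ℕ → ℕ) → α := fun n z => f n fun j => z (Nat.pair n j)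
  have hF : ∀ n, Continuous (F n) := fun n => by
    have := hf n
    fun_prop
  let C : List ℕ → Set (ℕ → ℕ) := fun s => {w | (List.range s.length).map w = s}
  have key : ∃ S : ℕ → Set α, (∀ n, MeasurableSet (S n)) ∧ (∀ n, F n '' C [] ⊆ S n) ∧
      ⋂ n, S n = ∅ := by
    refine bar_induction (Q := fun s => ∃ S : ℕ → Set α, (∀ n, MeasurableSet (S n)) ∧
      (∀ n, F n '' C s ⊆ S n) ∧ ⋂ n, S n = ∅) ?_ ?_
    · intro s hs
      choose S hSm hSs hS using hs
      classical
      let n₀ := s.length.unpair.1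
      refine ⟨fun n => if n = n₀ then ⋃ i, S i n else ⋂ i, S i n, fun n => ?_, fun n => ?_, ?_⟩
      · dsimp only
        split_ifs
        · exact .iUnion fun i => hSm i n
        · exact .iInter fun i => hSm i n
      · rintro _ ⟨w, hw, rfl⟩
        have hw : (List.range s.length).map w = s := hw
        dsimp only
        split_ifs with hn
        · refine Set.mem_iUnion.2 ⟨w s.length, hSs _ n ⟨w, ?_, rfl⟩⟩
          simp [C, List.range_succ, hw]
        · refine Set.mem_iInter.2 fun i =>
            hSs i n ⟨Function.update w s.length i, ?_, congrArg (f n) (funext fun j => ?_)⟩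
          · have : (List.range s.length).map (Function.update w s.length i) = s := by
              conv_rhs => rw [← hw]
              refine List.map_congr_left fun j hj => ?_
              exact Function.update_of_ne (List.mem_range.1 hj).ne _ _
            simp [C, List.range_succ, this]
          · refine Function.update_of_ne (fun hj => hn ?_) _ _
            simp [n₀, ← hj]
      · refine Set.eq_empty_of_forall_notMem fun x hx => ?_
        rw [Set.mem_iInter] at hx
        have h₀ := hx n₀
        rw [if_pos rfl] at h₀
        obtain ⟨i, hi⟩ := Set.mem_iUnion.1 h₀
        refine (Set.eq_empty_iff_forall_notMem.1 (hS i)) x (Set.mem_iInter.2 fun n => ?_)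
        by_cases hn : n = n₀
        · exact hn ▸ hi
        · have := hx n
          rw [if_neg hn] at this
          exact Set.mem_iInter.1 this i
    · intro z
      have hne : ∃ m, F m z ≠ F 0 z := by
        by_contra! hall
        refine (Set.eq_empty_iff_forall_notMem.1 h) (F 0 z) (Set.mem_iInter.2 fun n => ?_)
        exact ⟨_, hall n⟩
      obtain ⟨m, hm⟩ := hne
      obtain ⟨U, V, hU, hV, hmU, hV0, hUV⟩ := t2_separation hm
      have hW : IsOpen (F m ⁻¹' U ∩ F 0 ⁻¹' V) := (hU.preimage (hF m)).inter (hV.preimage (hF 0))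
      obtain ⟨_, ⟨x, k, rfl⟩, hz, hsub⟩ :=
        (PiNat.isTopologicalBasis_cylinders fun _ => ℕ).exists_subset_of_mem_open
          (show z ∈ F m ⁻¹' U ∩ F 0 ⁻¹' V from ⟨hmU, hV0⟩) hW
      rw [PiNat.mem_cylinder_iff_eq] at hz
      rw [← hz] at hsub
      have hC : C ((List.range k).map z) ⊆ PiNat.cylinder z k := by
        intro w hw i hi
        have hw : (List.range ((List.range k).map z).length).map w = (List.range k).map z := hw
        rw [List.length_map, List.length_range] at hw
        exact List.map_inj_left.1 hw i (List.mem_range.2 hi)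
      have hm0 : m ≠ 0 := fun h => hm (by rw [h])
      classical
      refine ⟨k, fun n => if n = m then U else if n = 0 then V else Set.univ,
        fun n => ?_, fun n => ?_, ?_⟩
      · dsimp only
        split_ifs
        exacts [hU.measurableSet, hV.measurableSet, .univ]
      · rintro _ ⟨w, hw, rfl⟩
        have := hsub (hC hw)
        dsimp only
        split_ifs with h1 h2
        exacts [h1 ▸ this.1, h2 ▸ this.2, trivial]
      · refine Set.eq_empty_of_forall_notMem fun x hx => ?_
        rw [Set.mem_iInter] at hx
        have h1 := hx m
        have h2 := hx 0
        rw [if_pos rfl] at h1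
        rw [if_neg hm0.symm, if_pos rfl] at h2
        exact Set.disjoint_left.1 hUV h1 h2
  obtain ⟨S, hSm, hSs, hS⟩ := key
  refine ⟨S, hSm, fun n => ?_, hS⟩
  rintro _ ⟨z, rfl⟩
  exact hSs n ⟨fun j => z j.unpair.2, by simp [C], by simp [F]⟩

/-- The **Novikov separation theorem**: a sequence of analytic sets with empty intersection is
contained termwise in a sequence of Borel sets with empty intersection. -/
theorem exists_measurableSet_superset_iInter_eq_empty {α : Type*}
    [TopologicalSpace α] [T2Space α] [MeasurableSpace α] [OpensMeasurableSpace α]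
    {A : ℕ → Set α} (hA : ∀ n, AnalyticSet (A n)) (h : ⋂ n, A n = ∅) :
    ∃ S : ℕ → Set α, (∀ n, MeasurableSet (S n)) ∧ (∀ n, A n ⊆ S n) ∧ ⋂ n, S n = ∅ := by
  by_cases hne : ∃ m, A m = ∅
  · obtain ⟨m, hm⟩ := hne
    classical
    refine ⟨fun n => if n = m then ∅ else Set.univ, fun n => ?_, fun n => ?_, ?_⟩
    · dsimp only
      split_ifs
      exacts [.empty, .univ]
    · dsimp only
      split_ifs with hn
      exacts [(hn ▸ hm).subset, Set.subset_univ _]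
    · exact Set.eq_empty_of_forall_notMem fun x hx => by simpa using Set.mem_iInter.1 hx m
  · have : ∀ n, ∃ f : (ℕ → ℕ) → α, Continuous f ∧ Set.range f = A n := by
      intro n
      have hn := hA n
      rw [AnalyticSet] at hn
      exact hn.resolve_left fun h => hne ⟨n, h⟩
    choose f hf hfA using this
    simp only [← hfA] at h ⊢
    exact exists_measurableSet_superset_iInter_eq_empty_of_continuous hf h

/-- In a standard Borel space, countably many Borel sets isolate the points of finite sets. -/
theorem exists_measurableSet_isolating (Y : Type*) [MeasurableSpace Y] [StandardBorelSpace Y] :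
    ∃ U : ℕ → Set Y, (∀ k, MeasurableSet (U k)) ∧
      ∀ F : Set Y, F.Finite → ∀ y ∈ F, ∃ k, y ∈ U k ∧ ∀ y' ∈ F, y' ∈ U k → y' = y := by
  let _ := upgradeStandardBorel Y
  obtain ⟨U, hU⟩ := ((TopologicalSpace.countable_countableBasis Y).insert
    Set.univ).exists_eq_range (Set.insert_nonempty _ _)
  refine ⟨U, fun k => ?_, fun F hF y hy => ?_⟩
  · rcases hU.symm ▸ Set.mem_range_self k with h | h
    · exact h ▸ .univ
    · exact (TopologicalSpace.isOpen_of_mem_countableBasis h).measurableSet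
  · obtain ⟨V, hV, hyV, hsub⟩ :=
      (TopologicalSpace.isBasis_countableBasis Y).exists_subset_of_mem_open
        (show y ∈ (F \ {y})ᶜ by simp) (hF.sdiff.isClosed.isOpen_compl)
    obtain ⟨k, rfl⟩ := hU ▸ Set.mem_insert_of_mem _ hV
    refine ⟨k, hyV, fun y' hy' hk => ?_⟩
    by_contra hne
    exact hsub hk ⟨hy', hne⟩

/-- A Borel relation with finite sections is a countable union of Borel partial functions. -/
theorem exists_measurableSet_injOn_fst_iUnion_eq {X Y : Type*} [MeasurableSpace X]
    [StandardBorelSpace X] [MeasurableSpace Y] [StandardBorelSpace Y] {R : Set (X × Y)}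
    (hR : MeasurableSet R) (hfin : ∀ x, {y | (x, y) ∈ R}.Finite) :
    ∃ S : ℕ → Set (X × Y), (∀ k, MeasurableSet (S k)) ∧ (∀ k, Set.InjOn Prod.fst (S k)) ∧
      ⋃ k, S k = R := by
  obtain ⟨U, hUm, hU⟩ := exists_measurableSet_isolating Y
  let _ := upgradeStandardBorel X
  let _ := upgradeStandardBorel Y
  let A : ℕ → Set (X × Y) := fun k =>
    (R ∩ Prod.snd ⁻¹' (U k)ᶜ) ∪
      Prod.fst '' {p : (X × Y) × Y | p.1 ∈ R ∧ (p.1.1, p.2) ∈ R ∧ p.2 ∈ U k ∧ p.2 ≠ p.1.2}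
  have hA : ∀ k, AnalyticSet (A k) := by
    intro k
    have h₁ : MeasurableSet (R ∩ Prod.snd ⁻¹' (U k)ᶜ) := hR.inter (measurable_snd (hUm k).compl)
    have h₂ : MeasurableSet
        {p : (X × Y) × Y | p.1 ∈ R ∧ (p.1.1, p.2) ∈ R ∧ p.2 ∈ U k ∧ p.2 ≠ p.1.2} := by
      refine (measurable_fst hR).inter (.inter ?_ (.inter (measurable_snd (hUm k)) ?_))
      · exact (measurable_fst.fst.prodMk measurable_snd) hR
      · exact (measurableSet_eq_fun measurable_snd measurable_fst.snd).compl
    have := AnalyticSet.iUnion (s := fun b : Bool => cond b (R ∩ Prod.snd ⁻¹' (U k)ᶜ)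
      (Prod.fst '' {p : (X × Y) × Y | p.1 ∈ R ∧ (p.1.1, p.2) ∈ R ∧ p.2 ∈ U k ∧ p.2 ≠ p.1.2}))
      (fun b => by
        cases b
        exacts [h₂.analyticSet_image measurable_fst, h₁.analyticSet])
    rwa [← Set.union_eq_iUnion] at this
  have hAe : ⋂ k, A k = ∅ := by
    refine Set.eq_empty_of_forall_notMem fun p hp => ?_
    rw [Set.mem_iInter] at hp
    have hpR : p ∈ R := by
      rcases hp 0 with h | ⟨q, hq, rfl⟩
      exacts [h.1, hq.1]
    obtain ⟨k, hk, hk'⟩ := hU _ (hfin p.1) p.2 hpR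
    rcases hp k with h | ⟨q, hq, rfl⟩
    exacts [h.2 hk, hq.2.2.2 (hk' _ hq.2.1 hq.2.2.1)]
  obtain ⟨S, hSm, hAS, hS⟩ := exists_measurableSet_superset_iInter_eq_empty hA hAe
  refine ⟨fun k => R \ S k, fun k => hR.diff (hSm k), ?_, ?_⟩
  · rintro k ⟨x, y⟩ ⟨hy, hyS⟩ ⟨x', y'⟩ ⟨hy', hyS'⟩ (rfl : x = x')
    by_contra hne
    refine hyS (hAS k (Or.inr ⟨((x, y), y'), ⟨hy, hy', ?_, fun h => hne ?_⟩, rfl⟩))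
    · by_contra hU'
      exact hyS' (hAS k (Or.inl ⟨hy', hU'⟩))
    · exact Prod.ext rfl h.symm
  · rw [← Set.sdiff_iInter, hS, Set.sdiff_empty]

/-- The projection of a Borel set with finite sections is Borel. -/
theorem measurableSet_setOf_exists_of_finite {X Y : Type*} [MeasurableSpace X]
    [StandardBorelSpace X] [MeasurableSpace Y] [StandardBorelSpace Y] {R : Set (X × Y)}
    (hR : MeasurableSet R) (hfin : ∀ x, {y | (x, y) ∈ R}.Finite) :
    MeasurableSet {x | ∃ y, (x, y) ∈ R} := by
  obtain ⟨S, hSm, hSi, rfl⟩ := exists_measurableSet_injOn_fst_iUnion_eq hR hfin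
  have : {x | ∃ y, (x, y) ∈ ⋃ k, S k} = ⋃ k, Prod.fst '' S k := by
    ext x
    simp only [Set.mem_ofPred_eq, Set.mem_iUnion, Set.mem_image, Prod.exists, exists_and_right,
      exists_eq_right]
    exact exists_comm
  rw [this]
  exact .iUnion fun k => (hSm k).image_of_measurable_injOn measurable_fst (hSi k)

/-- **Lusin–Novikov uniformization** for finite sections: a Borel relation with finite sections is
enumerated by countably many Borel functions, each of them considered on a Borel set. -/
theorem exists_measurable_enumeration_of_finite {X Y : Type*} [MeasurableSpace X]
    [StandardBorelSpace X] [MeasurableSpace Y] [StandardBorelSpace Y] [Nonempty Y]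
    {R : Set (X × Y)} (hR : MeasurableSet R) (hfin : ∀ x, {y | (x, y) ∈ R}.Finite) :
    ∃ (D : ℕ → Set X) (h : ℕ → X → Y), (∀ k, MeasurableSet (D k)) ∧ (∀ k, Measurable (h k)) ∧
      ∀ x y, (x, y) ∈ R ↔ ∃ k, x ∈ D k ∧ h k x = y := by
  classical
  obtain ⟨S, hSm, hSi, rfl⟩ := exists_measurableSet_injOn_fst_iUnion_eq hR hfin
  have hD : ∀ k, MeasurableSet (Prod.fst '' S k) := fun k =>
    (hSm k).image_of_measurable_injOn measurable_fst (hSi k)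
  have hex : ∀ k x, ∃ y, x ∈ Prod.fst '' S k → (x, y) ∈ S k := by
    intro k x
    by_cases hx : x ∈ Prod.fst '' S k
    · obtain ⟨p, hp, rfl⟩ := hx
      exact ⟨p.2, fun _ => hp⟩
    · exact ⟨Classical.arbitrary Y, fun h => absurd h hx⟩
  choose g hg using hex
  have huniq : ∀ k x y, (x, y) ∈ S k → g k x = y := fun k x y hy =>
    congrArg Prod.snd (hSi k (hg k x ⟨_, hy, rfl⟩) hy rfl)
  refine ⟨fun k => Prod.fst '' S k,
    fun k x => if x ∈ Prod.fst '' S k then g k x else Classical.arbitrary Y, hD, fun k V hV => ?_,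
    fun x y => ?_⟩
  · have : (fun x => if x ∈ Prod.fst '' S k then g k x else Classical.arbitrary Y) ⁻¹' V =
        Prod.fst '' (S k ∩ Prod.snd ⁻¹' V) ∪
          ((Prod.fst '' S k)ᶜ ∩ {_x | Classical.arbitrary Y ∈ V}) := by
      ext x
      by_cases hx : x ∈ Prod.fst '' S k
      · simp only [Set.mem_preimage, Set.mem_union, Set.mem_inter_iff, Set.mem_compl_iff,
          hx, not_true_eq_false, false_and, or_false]
        constructor
        · exact fun h => ⟨(x, g k x), ⟨hg k x hx, h⟩, rfl⟩
        · rintro ⟨⟨x, y⟩, ⟨hp, hV⟩, rfl⟩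
          rwa [huniq k x y hp]
      · simp only [Set.mem_preimage, Set.mem_union, Set.mem_inter_iff, Set.mem_compl_iff,
          hx, not_false_eq_true, true_and, Set.mem_ofPred_eq]
        refine ⟨Or.inr, fun h => h.resolve_left ?_⟩
        rintro ⟨p, hp, rfl⟩
        exact hx ⟨p, hp.1, rfl⟩
    rw [this]
    exact (((hSm k).inter (measurable_snd hV)).image_of_measurable_injOn measurable_fst
      ((hSi k).mono Set.inter_subset_left)).union ((hD k).compl.inter (.const _))
  · rw [Set.mem_iUnion]
    refine exists_congr fun k => ⟨fun h => ?_, fun ⟨hx, h⟩ => ?_⟩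
    · have hx : x ∈ Prod.fst '' S k := ⟨_, h, rfl⟩
      exact ⟨hx, (if_pos hx).trans (huniq k x y h)⟩
    · obtain rfl : g k x = y := (if_pos hx).symm.trans h
      exact hg k x hx

/-- A locally finite Borel graph has a countable Borel coloring. -/
theorem exists_measurable_nat_coloring {Z : Type*} [MeasurableSpace Z] [StandardBorelSpace Z]
    (H : SimpleGraph Z) (hH : MeasurableSet {p : Z × Z | H.Adj p.1 p.2})
    (hfin : ∀ z, (H.neighborSet z).Finite) :
    ∃ c : Z → ℕ, Measurable c ∧ ∀ x y, H.Adj x y → c x ≠ c y := by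
  classical
  obtain ⟨U, hUm, hU⟩ := exists_measurableSet_isolating Z
  have hex : ∀ z, ∃ k, z ∈ U k ∧ ¬ ∃ w, H.Adj z w ∧ w ∈ U k := by
    intro z
    obtain ⟨k, hk, hk'⟩ := hU _ ((hfin z).insert z) z (Set.mem_insert _ _)
    refine ⟨k, hk, ?_⟩
    rintro ⟨w, hw, hwk⟩
    exact H.ne_of_adj hw (hk' w (Set.mem_insert_of_mem _ hw) hwk).symm
  refine ⟨fun z => Nat.find (hex z), measurable_find hex fun k => (hUm k).inter (.compl ?_),
    fun x y hxy heq => ?_⟩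
  · exact measurableSet_setOf_exists_of_finite (hH.inter (measurable_snd (hUm k)))
      fun z => (hfin z).subset fun w hw => hw.1
  · have heq : Nat.find (hex x) = Nat.find (hex y) := heq
    refine (Nat.find_spec (hex x)).2 ⟨y, hxy, ?_⟩
    rw [heq]
    exact (Nat.find_spec (hex y)).1

/-- **Greedy Borel coloring.** A Borel assignment of finite lists, in which the list of every vertex
is longer than its number of neighbors preceding it in some Borel stratification into countably many
well-ordered independent levels, admits a Borel coloring from these lists. -/
theorem exists_measurable_list_coloring_of_lt {Z Y K : Type*} [MeasurableSpace Z]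
    [StandardBorelSpace Z] [MeasurableSpace Y] [StandardBorelSpace Y] [LinearOrder K]
    [WellFoundedLT K] [Countable K] [MeasurableSpace K] [MeasurableSingletonClass K]
    (H : SimpleGraph Z) (hH : MeasurableSet {p : Z × Z | H.Adj p.1 p.2})
    (hfin : ∀ z, (H.neighborSet z).Finite) {key : Z → K} (hkey : Measurable key)
    (hind : ∀ x y, H.Adj x y → key x ≠ key y) {L : Z → Finset Y}
    (hL : MeasurableSet {p : Z × Y | p.2 ∈ L p.1})
    (hcard : ∀ z, {w | H.Adj z w ∧ key w < key z}.ncard < (L z).card) :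
    ∃ c : Z → Y, Measurable c ∧ (∀ z, c z ∈ L z) ∧ ∀ x y, H.Adj x y → c x ≠ c y := by
  classical
  rcases isEmpty_or_nonempty Z with hZ | ⟨⟨z₀⟩⟩
  · exact ⟨isEmptyElim, measurable_of_empty _, isEmptyElim, isEmptyElim⟩
  have : Nonempty Y := ⟨(Finset.card_pos.1 ((Nat.zero_le _).trans_lt (hcard z₀))).choose⟩
  obtain ⟨D, h, hD, hh, hDh⟩ := exists_measurable_enumeration_of_finite hL
    fun z => (L z).finite_toSet
  have hex : ∀ (z : Z) (r : Z → Y), ∃ k, z ∈ D k ∧ ¬ ∃ w, (H.Adj z w ∧ key w < key z) ∧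
      r w = h k z := by
    intro z r
    have hf : {w | H.Adj z w ∧ key w < key z}.Finite := (hfin z).subset fun w hw => hw.1
    have : ∃ y ∈ (L z : Set Y), y ∉ r '' {w | H.Adj z w ∧ key w < key z} := by
      refine Set.exists_mem_notMem_of_ncard_lt_ncard ?_ (hf.image r)
      rw [Set.ncard_coe_finset]
      exact (Set.ncard_image_le hf).trans_lt (hcard z)
    obtain ⟨y, hy, hyr⟩ := this
    obtain ⟨k, hk, rfl⟩ := (hDh z y).1 hy
    exact ⟨k, hk, fun ⟨w, hw, hwr⟩ => hyr ⟨w, hw, hwr⟩⟩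
  have hwf : WellFounded fun z w : Z => key z < key w := InvImage.wf key wellFounded_lt
  let c : Z → Y := hwf.fix fun z ih =>
    h (Nat.find (hex z fun w => if hw : key w < key z then ih w hw else h 0 w)) z
  have hexc : ∀ z, ∃ k, z ∈ D k ∧ ¬ ∃ w, (H.Adj z w ∧ key w < key z) ∧ c w = h k z :=
    fun z => hex z c
  have hc : ∀ z, c z = h (Nat.find (hexc z)) z := by
    intro z
    rw [show c z = _ from hwf.fix_eq _ z]
    congr 1
    refine Nat.find_congr' fun {k} => and_congr_right fun _ => not_congr (exists_congr fun w =>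
      and_congr_right fun hw => ?_)
    rw [dif_pos hw.2]
  refine ⟨c, ?_, fun z => ?_, ?_⟩
  · have hlevel : ∀ κ, ∀ V, MeasurableSet V → MeasurableSet {z | key z = κ ∧ c z ∈ V} := by
      intro κ
      induction κ using WellFoundedLT.induction with
      | ind κ ih =>
        intro V hV
        have hlt : MeasurableSet {z | key z < κ} :=
          hkey (Set.to_countable (Set.Iio κ)).measurableSet
        have hc' : Measurable fun z => if key z < κ then c z else Classical.arbitrary Y := by
          intro W hW
          have : (fun z => if key z < κ then c z else Classical.arbitrary Y) ⁻¹' W =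
              (⋃ κ' : Set.Iio κ, {z | key z = κ' ∧ c z ∈ W}) ∪
                ({z | key z < κ}ᶜ ∩ {_z | Classical.arbitrary Y ∈ W}) := by
            ext z
            by_cases hz : key z < κ <;> simp [hz]
          rw [this]
          exact (MeasurableSet.iUnion fun κ' : Set.Iio κ => ih κ' κ'.2 W hW).union
            (hlt.compl.inter (.const _))
        have hE : ∀ k, MeasurableSet {z | ∃ w, (H.Adj z w ∧ key w < κ) ∧ c w = h k z} := by
          intro k
          have : MeasurableSet {p : Z × Z | (H.Adj p.1 p.2 ∧ key p.2 < κ) ∧ c p.2 = h k p.1} := by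
            have h₁ : MeasurableSet {p : Z × Z | H.Adj p.1 p.2 ∧ key p.2 < κ} :=
              hH.inter (measurable_snd hlt)
            have h₂ := h₁.inter (measurableSet_eq_fun (hc'.comp measurable_snd)
              ((hh k).comp measurable_fst))
            convert h₂ using 1
            ext p
            refine and_congr_right fun hp => ?_
            simp [hp.2]
          exact measurableSet_setOf_exists_of_finite this
            fun z => (hfin z).subset fun w hw => hw.1.1
        let E : ℕ → Set Z := fun k => D k \ {z | ∃ w, (H.Adj z w ∧ key w < κ) ∧ c w = h k z}
        have hEm : ∀ k, MeasurableSet (E k) := fun k => (hD k).diff (hE k)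
        have : {z | key z = κ ∧ c z ∈ V} =
            {z | key z = κ} ∩ ⋃ k, (E k \ ⋃ j : Set.Iio k, E j) ∩ h k ⁻¹' V := by
          ext z
          refine and_congr_right fun hz => ?_
          have hz : key z = κ := hz
          have hEz : ∀ k, z ∈ E k ↔
              z ∈ D k ∧ ¬ ∃ w, (H.Adj z w ∧ key w < key z) ∧ c w = h k z := fun k => by
            rw [hz]; rfl
          rw [hc z, Set.mem_iUnion]
          have hfind : ∀ k, z ∈ E k \ ⋃ j : Set.Iio k, E j ↔ Nat.find (hexc z) = k := by
            intro k
            rw [Nat.find_eq_iff, ← hEz]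
            simp only [← hEz]
            simp
          simp only [Set.mem_inter_iff, hfind, Set.mem_preimage, exists_eq_left']
        rw [this]
        exact (hkey (measurableSet_singleton κ)).inter (.iUnion fun k =>
          ((hEm k).diff (.iUnion fun j : Set.Iio k => hEm j)).inter (hh k hV))
    intro V hV
    have : c ⁻¹' V = ⋃ κ, {z | key z = κ ∧ c z ∈ V} := by
      ext z
      simp
    rw [this]
    exact .iUnion fun κ => hlevel κ V hV
  · exact (hDh z (c z)).2 ⟨_, (Nat.find_spec (hexc z)).1, (hc z).symm⟩
  · have hlt : ∀ x y, H.Adj x y → key y < key x → c x ≠ c y := fun x y hxy hk he =>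
      (Nat.find_spec (hexc x)).2 ⟨y, ⟨hxy, hk⟩, by rw [← he]; exact hc x⟩
    intro x y hxy
    rcases (hind x y hxy).lt_or_gt with hk | hk
    exacts [(hlt y x hxy.symm hk).symm, hlt x y hxy hk]

/-- A one-ended Borel function that is finite-to-one admits a Borel rank into `ℕ` which increases
along the function. -/
theorem OneEnded.exists_measurable_rank {X : Type*} [MeasurableSpace X] [StandardBorelSpace X]
    {B : Set X} (hB : MeasurableSet B) {f : B → X} (hone : OneEnded f) (hf : Measurable f)
    (hfin : ∀ x, (f ⁻¹' {x}).Finite) :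
    ∃ e : B → ℕ, Measurable e ∧ ∀ x y : B, f x = y → e x < e y := by
  classical
  have := hB.standardBorel
  obtain ⟨T, hT0, hTs⟩ : ∃ T : ℕ → Set B, T 0 = Set.univ ∧
      ∀ n, T (n + 1) = {z : B | ∃ w, f w = z ∧ w ∈ T n} :=
    ⟨fun n => n.rec Set.univ (fun _ T => {z | ∃ w, f w = z ∧ w ∈ T}), rfl, fun _ => rfl⟩
  have hTm : ∀ n, MeasurableSet (T n) := by
    intro n
    induction n with
    | zero => exact hT0 ▸ .univ
    | succ n ih =>
      rw [hTs]
      have hR : MeasurableSet {p : B × B | f p.2 = p.1 ∧ p.2 ∈ T n} :=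
        (measurableSet_eq_fun (hf.comp measurable_snd)
          (measurable_subtype_coe.comp measurable_fst)).inter (measurable_snd ih)
      exact measurableSet_setOf_exists_of_finite hR fun z => (hfin z).subset fun w hw => hw.1
  have hanti : Antitone T := by
    refine antitone_nat_of_succ_le fun n => ?_
    induction n with
    | zero => exact hT0 ▸ Set.subset_univ _
    | succ n ih =>
      rintro z hz
      obtain ⟨w, hw, hwT⟩ := hTs (n + 1) ▸ hz
      exact hTs n ▸ ⟨w, hw, ih hwT⟩
  have hstep : ∀ z : B, (∀ n, z ∈ T n) → ∃ w : B, f w = z ∧ ∀ n, w ∈ T n := by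
    intro z hz
    by_contra! hcon
    choose! m hm using hcon
    obtain ⟨M, hM⟩ := ((hfin z).image m).bddAbove
    obtain ⟨w, hw, hwT⟩ := hTs M ▸ hz (M + 1)
    exact hm w hw (hanti (hM ⟨w, hw, rfl⟩) hwT)
  have hex : ∀ z, ∃ n, z ∉ T n := by
    intro z
    by_contra! hz
    choose g hg hgT using hstep
    let u : ℕ → {z : B // ∀ n, z ∈ T n} := fun n =>
      n.rec ⟨z, hz⟩ (fun _ w => ⟨g w.1 w.2, hgT w.1 w.2⟩)
    exact hone ⟨fun n => (u n).1, fun n => hg (u n).1 (u n).2⟩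
  refine ⟨fun z => Nat.find (hex z), measurable_find hex fun n => (hTm n).compl,
    fun x y hxy => ?_⟩
  refine (Nat.lt_find_iff (hex y) _).2 fun n hn hnT => hnT ?_
  cases n with
  | zero => exact hT0 ▸ Set.mem_univ _
  | succ n =>
    rw [hTs]
    refine ⟨x, hxy, ?_⟩
    by_contra hx
    exact (Nat.find_min' (hex x) hx).not_gt hn

theorem stmt_15 {X : Type*} [MeasurableSpace X] [StandardBorelSpace X]
    (G : SimpleGraph X) (hGmeas : MeasurableSet {p : X × X | G.Adj p.1 p.2})
    (hlf : ∀ x : X, (G.neighborSet x).Finite)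
    (B : Set X) (hB : MeasurableSet B)
    (f : B → X) (hf : Measurable f) (hfG : ∀ x : B, G.Adj (x : X) (f x))
    (hfone : OneEnded f)
    (Y : Type*) [TopologicalSpace Y] [MeasurableSpace Y] [PolishSpace Y] [BorelSpace Y]
    (L : B → Finset Y)
    (hLmeas : ∀ U : Set Y, IsOpen U → MeasurableSet {x : B | ∃ y ∈ L x, y ∈ U})
    (hLcard : ∀ x : B, (G.neighborSet (x : X)).ncard ≤ (L x).card) :
    ∃ c : B → Y, Measurable c ∧ (∀ x : B, c x ∈ L x) ∧
      ∀ x y : B, G.Adj (x : X) (y : X) → c x ≠ c y := by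
  classical
  have := hB.standardBorel
  let H : SimpleGraph B := G.comap (↑)
  have hH : MeasurableSet {p : B × B | H.Adj p.1 p.2} :=
    ((measurable_subtype_coe.comp measurable_fst).prodMk
      (measurable_subtype_coe.comp measurable_snd)) hGmeas
  have hHfin : ∀ z, (H.neighborSet z).Finite := fun z =>
    (hlf z).preimage Subtype.val_injective.injOn
  obtain ⟨e, he, hef⟩ := hfone.exists_measurable_rank hB hf fun x =>
    ((hlf x).preimage Subtype.val_injective.injOn).subset fun z (hz : f z = x) =>
      show G.Adj x z from hz ▸ (hfG z).symm
  obtain ⟨d, hd, hdH⟩ := exists_measurable_nat_coloring H hH hHfin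
  let _ : MeasurableSpace (ℕ ×ₗ ℕ) := ⊤
  have : Countable (ℕ ×ₗ ℕ) := (ofLex (α := ℕ × ℕ)).injective.countable
  have hkey : Measurable fun z => toLex (e z, d z) :=
    (Measurable.of_discrete (f := (toLex : ℕ × ℕ → ℕ ×ₗ ℕ))).comp (he.prodMk hd)
  have hL : MeasurableSet {p : B × Y | p.2 ∈ L p.1} := by
    have : {p : B × Y | p.2 ∈ L p.1} = ⋂ U ∈ TopologicalSpace.countableBasis Y,
        {p : B × Y | p.2 ∈ U → ∃ y ∈ L p.1, y ∈ U} := by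
      ext ⟨z, y⟩
      simp only [Set.mem_ofPred_eq, Set.mem_iInter]
      refine ⟨fun hy U _ hyU => ⟨y, hy, hyU⟩, fun h => ?_⟩
      by_contra hy
      obtain ⟨U, hU, hyU, hsub⟩ :=
        (TopologicalSpace.isBasis_countableBasis Y).exists_subset_of_mem_open
          (show y ∈ (L z : Set Y)ᶜ from hy) (L z).finite_toSet.isClosed.isOpen_compl
      obtain ⟨y', hy', hyU'⟩ := h U hU hyU
      exact hsub hyU' hy'
    rw [this]
    refine .biInter (TopologicalSpace.countable_countableBasis Y) fun U hU => ?_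
    have hUo := TopologicalSpace.isOpen_of_mem_countableBasis hU
    exact (measurable_snd hUo.measurableSet).imp (measurable_fst (hLmeas U hUo))
  refine exists_measurable_list_coloring_of_lt H hH hHfin hkey (fun x y hxy h => ?_) hL
    fun z => (?_ : _ < _).trans_le (hLcard z)
  · exact hdH x y hxy (congrArg (fun p => (ofLex p).2) h)
  · rw [← Set.ncard_image_of_injective _ Subtype.val_injective]
    refine Set.ncard_lt_ncard ?_ (hlf z)
    refine (Set.ssubset_iff_of_subset ?_).2 ⟨f z, hfG z, ?_⟩
    · rintro _ ⟨w, hw, rfl⟩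
      exact hw.1
    · rintro ⟨w, hw, hwf⟩
      exact (Prod.Lex.toLex_lt_toLex.1 hw.2).elim (hef z w hwf.symm).not_gt
        fun h => (hef z w hwf.symm).ne' h.1
end

section
/- Let G be a locally finite Borel graph on a standard Borel space X, and suppose there exists a one-ended Borel function f : X → X whose graph is contained in G. Then G is Borel degree-list-colorable: for every Polish space Y and every Borel function L : X → [Y]^{<∞} with |L(x)| equal to the degree of x for every x ∈ X, there is a Borel map c : X → Y such that c(x) ∈ L(x) for all x and c(x) ≠ c(y) whenever x and y are adjacent. -/
open MeasureTheory

/-- A Borel family of nonempty finite sets whose cardinality function is Borel can be enumerated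
by countably many Borel functions. -/
theorem exists_measurable_enumeration {X Y : Type*} [MeasurableSpace X] [StandardBorelSpace X]
    [MeasurableSpace Y] [StandardBorelSpace Y] (S : X → Finset Y)
    (hS : MeasurableSet {p : X × Y | p.2 ∈ S p.1})
    (hcard : ∀ k : ℕ, MeasurableSet {x | (S x).card = k}) (hne : ∀ x, (S x).Nonempty) :
    ∃ g : ℕ → X → Y, (∀ i, Measurable (g i)) ∧ ∀ x y, y ∈ S x ↔ ∃ i, g i x = y := by
  classical
  set e : Y → ℝ := embeddingReal Y
  have he : MeasurableEmbedding e := measurableEmbedding_embeddingReal Y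
  have himg : ∀ x, ((S x).image e).card = (S x).card := fun x =>
    Finset.card_image_of_injective _ he.injective
  have hex : ∀ x, ∃ v : Fin (S x).card → Y, (∀ i, v i ∈ S x) ∧ StrictMono (e ∘ v) ∧
      ∀ y ∈ S x, ∃ i, v i = y := by
    intro x
    have hv : ∀ i, ∃ y ∈ S x, e y = ((S x).image e).orderEmbOfFin (himg x) i := fun i => by
      exact Finset.mem_image.1 (Finset.orderEmbOfFin_mem _ (himg x) i)
    choose v hvS hve using hv
    have hcomp : e ∘ v = ((S x).image e).orderEmbOfFin (himg x) := funext hve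
    refine ⟨v, hvS, hcomp ▸ OrderEmbedding.strictMono _, fun y hy => ?_⟩
    have hy' : e y ∈ Set.range (((S x).image e).orderEmbOfFin (himg x)) := by
      rw [Finset.range_orderEmbOfFin]
      exact Finset.mem_coe.2 (Finset.mem_image_of_mem e hy)
    obtain ⟨i, hi⟩ := hy'
    exact ⟨i, he.injective ((hve i).trans hi)⟩
  choose v hvS hmono hsurj using hex
  have hpos : ∀ x, 0 < (S x).card := fun x => Finset.card_pos.2 (hne x)
  refine ⟨fun i x => v x ⟨i % (S x).card, Nat.mod_lt _ (hpos x)⟩, fun i B hB => ?_,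
    fun x y => ⟨fun hy => ?_, ?_⟩⟩
  · let W : ∀ k : ℕ, Set (X × (Fin k → Y)) := fun k =>
      {p | (S p.1).card = k} ∩ ({p | ∀ j, p.2 j ∈ S p.1} ∩
        ({p | ∀ a b, a < b → e (p.2 a) < e (p.2 b)} ∩
          {p | ∃ hk : 0 < k, p.2 ⟨i % k, Nat.mod_lt _ hk⟩ ∈ B}))
    have hW : ∀ k, MeasurableSet (W k) := fun k => by
      refine (measurable_fst (hcard k)).inter (.inter ?_ (.inter ?_ ?_))
      · rw [Set.ofPred_forall]
        refine .iInter fun j => ?_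
        have hm : Measurable fun p : X × (Fin k → Y) => (p.1, p.2 j) :=
          measurable_fst.prodMk ((measurable_pi_apply j).comp measurable_snd)
        exact hm hS
      · simp only [Set.ofPred_forall]
        refine .iInter fun a => .iInter fun b => .iInter fun _ => ?_
        exact measurableSet_lt
          (he.measurable.comp ((measurable_pi_apply a).comp measurable_snd))
          (he.measurable.comp ((measurable_pi_apply b).comp measurable_snd))
      · rw [Set.ofPred_exists]
        exact .iUnion fun hk => ((measurable_pi_apply _).comp measurable_snd) hB
    have hinj : ∀ k, Set.InjOn Prod.fst (W k) := by
      rintro k ⟨x, w⟩ ⟨hk, hw, hwm, -⟩ ⟨x', w'⟩ ⟨-, hw', hwm', -⟩ hx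
      obtain rfl : x = x' := hx
      have h1 := Finset.orderEmbOfFin_unique ((himg x).trans hk) (f := e ∘ w)
        (fun j => Finset.mem_image_of_mem e (hw j)) (fun a b hab => hwm a b hab)
      have h2 := Finset.orderEmbOfFin_unique ((himg x).trans hk) (f := e ∘ w')
        (fun j => Finset.mem_image_of_mem e (hw' j)) (fun a b hab => hwm' a b hab)
      have h3 : w = w' := funext fun j => he.injective (congrFun (h1.trans h2.symm) j)
      rw [h3]
    have heq : (fun x => v x ⟨i % (S x).card, Nat.mod_lt _ (hpos x)⟩) ⁻¹' B
        = ⋃ k, Prod.fst '' (W k) := by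
      ext x
      simp only [Set.mem_preimage, Set.mem_iUnion, Set.mem_image]
      constructor
      · exact fun hx => ⟨(S x).card, (x, v x), ⟨rfl, hvS x, fun a b hab => hmono x hab,
          hpos x, hx⟩, rfl⟩
      · rintro ⟨k, ⟨x', w⟩, ⟨hk', hw, hwm, hk, hB'⟩, rfl⟩
        obtain rfl : (S x').card = k := hk'
        have h1 := Finset.orderEmbOfFin_unique (himg x') (f := e ∘ w)
          (fun j => Finset.mem_image_of_mem e (hw j)) (fun a b hab => hwm a b hab)
        have h2 := Finset.orderEmbOfFin_unique (himg x') (f := e ∘ v x')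
          (fun j => Finset.mem_image_of_mem e (hvS x' j)) (hmono x')
        have h3 : w = v x' := funext fun j => he.injective (congrFun (h1.trans h2.symm) j)
        rw [← h3]
        exact hB'
    rw [heq]
    exact .iUnion fun k => (hW k).image_of_measurable_injOn measurable_fst (hinj k)
  · obtain ⟨i, hi⟩ := hsurj x y hy
    refine ⟨i, ?_⟩
    simpa only [Nat.mod_eq_of_lt i.2] using hi
  · rintro ⟨i, rfl⟩
    exact hvS x _

/-- The graph of a Borel map into the finite subsets of a Polish space is Borel. -/
theorem measurableSet_graph_finset {X Y : Type*} [MeasurableSpace X] [TopologicalSpace Y]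
    [MeasurableSpace Y] [PolishSpace Y] [BorelSpace Y] (L : X → Finset Y)
    (hL : ∀ U : Set Y, IsOpen U → MeasurableSet {x : X | ∃ y ∈ L x, y ∈ U}) :
    MeasurableSet {p : X × Y | p.2 ∈ L p.1} := by
  have hb := TopologicalSpace.isBasis_countableBasis Y
  have heq : {p : X × Y | p.2 ∈ L p.1} = ⋂ U ∈ TopologicalSpace.countableBasis Y,
      ({p | p.2 ∈ U}ᶜ ∪ {p | ∃ y ∈ L p.1, y ∈ U}) := by
    ext ⟨x, y⟩
    simp only [Set.mem_ofPred_eq, Set.mem_iInter, Set.mem_union, Set.mem_compl_iff]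
    constructor
    · intro h U _
      by_cases hU : y ∈ U
      · exact .inr ⟨y, h, hU⟩
      · exact .inl hU
    · intro h
      by_contra hy
      obtain ⟨U, hU, hyU, hUL⟩ := hb.exists_subset_of_mem_open (a := y) (u := (↑(L x))ᶜ)
        (by simpa using hy) (L x).finite_toSet.isClosed.isOpen_compl
      rcases h U hU with h | ⟨z, hz, hzU⟩
      · exact h hyU
      · exact hUL hzU hz
  rw [heq]
  refine .biInter (TopologicalSpace.countable_countableBasis Y) fun U hU => ?_
  exact (measurable_snd (hb.isOpen hU).measurableSet).compl.union
    (measurable_fst (hL U (hb.isOpen hU)))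

/-- The cardinality of a Borel map into the finite subsets of a Polish space is Borel. -/
theorem measurableSet_card_finset_eq {X Y : Type*} [MeasurableSpace X] [TopologicalSpace Y]
    [PolishSpace Y] (L : X → Finset Y)
    (hL : ∀ U : Set Y, IsOpen U → MeasurableSet {x : X | ∃ y ∈ L x, y ∈ U}) (k : ℕ) :
    MeasurableSet {x | (L x).card = k} := by
  classical
  have hb := TopologicalSpace.isBasis_countableBasis Y
  have := (TopologicalSpace.countable_countableBasis Y).to_subtype
  have hle : ∀ k : ℕ, MeasurableSet {x | k ≤ (L x).card} := fun k => by
    have heq : {x | k ≤ (L x).card} = ⋃ F : Fin k → TopologicalSpace.countableBasis Y,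
        ⋃ _ : Pairwise fun i j => Disjoint (F i : Set Y) (F j),
          ⋂ i, {x | ∃ y ∈ L x, y ∈ (F i : Set Y)} := by
      ext x
      simp only [Set.mem_ofPred_eq, Set.mem_iUnion, Set.mem_iInter]
      constructor
      · intro hk
        obtain ⟨t, ht, htk⟩ := Finset.exists_subset_card_eq hk
        obtain ⟨U, hU, hd⟩ := t.finite_toSet.t2_separation
        choose V hV hyV hVU using fun y =>
          hb.exists_subset_of_mem_open (hU y).1 (hU y).2
        let σ := (Finset.equivFinOfCardEq htk).symm
        refine ⟨fun i => ⟨V (σ i), hV _⟩, fun i j hij => ?_, fun i => ⟨σ i, ht (σ i).2, hyV _⟩⟩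
        exact (hd (σ i).2 (σ j).2 fun h => hij (σ.injective (Subtype.ext h))).mono
          (hVU _) (hVU _)
      · rintro ⟨F, hd, hF⟩
        choose y hy hyF using hF
        have hinj : Function.Injective y := fun i j hij => by
          by_contra hne
          exact Set.disjoint_left.1 (hd hne) (hyF i) (hij ▸ hyF j)
        simpa using Finset.card_le_card_of_injOn (s := Finset.univ) y (fun i _ => hy i)
          hinj.injOn
    rw [heq]
    exact .iUnion fun F => .iUnion fun _ => .iInter fun i => hL _ (hb.isOpen (F i).2)
  have heq : {x | (L x).card = k} = {x | k ≤ (L x).card} \ {x | k + 1 ≤ (L x).card} := by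
    ext x
    simp only [Set.mem_ofPred_eq, Set.mem_sdiff]
    omega
  rw [heq]
  exact (hle k).diff (hle (k + 1))

/-- A locally finite Borel graph whose neighborhoods are enumerated by Borel functions has a
countable Borel proper coloring. -/
theorem exists_measurable_nat_coloring_s16 {X : Type*} [MeasurableSpace X] [StandardBorelSpace X]
    (G : SimpleGraph X) (hlf : ∀ x : X, (G.neighborSet x).Finite) (g : ℕ → X → X)
    (hg : ∀ i, Measurable (g i)) (hgG : ∀ x y, G.Adj x y ↔ ∃ i, g i x = y) :
    ∃ h : X → ℕ, Measurable h ∧ ∀ x y, G.Adj x y → h x ≠ h y := by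
  classical
  let _ := upgradeStandardBorel X
  have hb := TopologicalSpace.isBasis_countableBasis X
  cases isEmpty_or_nonempty X with
  | inl _ => exact ⟨fun _ => 0, measurable_const, fun x => isEmptyElim x⟩
  | inr hX =>
  have hbne : (TopologicalSpace.countableBasis X).Nonempty := by
    obtain ⟨x⟩ := hX
    obtain ⟨V, hV, -⟩ := hb.exists_subset_of_mem_open (Set.mem_univ x) isOpen_univ
    exact ⟨V, hV⟩
  obtain ⟨U, hU⟩ := (TopologicalSpace.countable_countableBasis X).exists_eq_range
    hbne
  have hUmeas : ∀ n, MeasurableSet (U n) := fun n =>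
    (hb.isOpen (hU ▸ Set.mem_range_self n)).measurableSet
  have hex : ∀ x, ∃ n, x ∈ U n ∧ ∀ i, g i x ∉ U n := by
    intro x
    obtain ⟨V, hV, hxV, hVG⟩ := hb.exists_subset_of_mem_open (a := x) (u := (G.neighborSet x)ᶜ)
      (by simp) (hlf x).isClosed.isOpen_compl
    rw [hU] at hV
    obtain ⟨n, rfl⟩ := hV
    exact ⟨n, hxV, fun i hi => hVG hi ((hgG x _).2 ⟨i, rfl⟩)⟩
  refine ⟨fun x => Nat.find (hex x), measurable_find hex fun n => ?_, fun x y hxy heq => ?_⟩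
  · simp only [Set.ofPred_and, Set.ofPred_forall]
    exact (hUmeas n).inter (.iInter fun i => (hg i (hUmeas n)).compl)
  · obtain ⟨i, rfl⟩ := (hgG x y).1 hxy
    have h1 := (Nat.find_spec (hex x)).2 i
    have h2 := (Nat.find_spec (hex (g i x))).1
    simp only at heq
    rw [heq] at h1
    exact h1 h2

/-- A one-ended Borel function contained in a locally finite Borel graph admits a Borel rank
function which increases strictly along it. -/
theorem exists_measurable_rank {X : Type*} [MeasurableSpace X] [StandardBorelSpace X]
    (G : SimpleGraph X) (hlf : ∀ x : X, (G.neighborSet x).Finite) (g : ℕ → X → X)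
    (hg : ∀ i, Measurable (g i)) (hgG : ∀ x y, G.Adj x y ↔ ∃ i, g i x = y)
    (f : X → X) (hf : Measurable f) (hfG : ∀ x : X, G.Adj x (f x))
    (hfone : ¬ ∃ u : ℕ → X, ∀ i : ℕ, f (u (i + 1)) = u i) :
    ∃ r : X → ℕ, Measurable r ∧ ∀ x, r x < r (f x) := by
  classical
  let R : ℕ → Set X := fun n => Nat.rec Set.univ (fun _ A => f '' A) n
  have hRs : ∀ n, R (n + 1) = f '' R n := fun n => rfl
  have hmeas : ∀ n, MeasurableSet (R n) := by
    intro n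
    induction n with
    | zero => exact .univ
    | succ n ih =>
      have heq : R (n + 1) = ⋃ i, {x | f (g i x) = x} ∩ g i ⁻¹' R n := by
        ext x
        simp only [hRs, Set.mem_image, Set.mem_iUnion, Set.mem_inter_iff, Set.mem_ofPred_eq,
          Set.mem_preimage]
        constructor
        · rintro ⟨y, hy, rfl⟩
          obtain ⟨i, hi⟩ := (hgG _ _).1 (hfG y).symm
          exact ⟨i, by rw [hi], by rwa [hi]⟩
        · rintro ⟨i, h1, h2⟩
          exact ⟨_, h2, h1⟩
      rw [heq]
      exact .iUnion fun i => (measurableSet_eq_fun (hf.comp (hg i)) measurable_id).inter (hg i ih)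
  have hanti : Antitone R := by
    refine antitone_nat_of_succ_le fun n => ?_
    induction n with
    | zero => exact Set.subset_univ _
    | succ n ih => exact Set.image_mono ih
  have hback : ∀ x, (∀ n, x ∈ R n) → ∃ y, f y = x ∧ ∀ n, y ∈ R n := by
    intro x hx
    by_contra hcon
    push Not at hcon
    have hfin : {y | f y = x}.Finite :=
      (hlf x).subset fun y (hy : f y = x) => (hy ▸ (hfG y).symm : G.Adj x y)
    choose! m hm using hcon
    obtain ⟨N, hN⟩ := (hfin.image m).bddAbove
    obtain ⟨y, hy, hyx⟩ := hx (N + 1)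
    exact hm y hyx (hanti (hN ⟨y, hyx, rfl⟩) hy)
  have hex : ∀ x, ∃ n, x ∉ R n := by
    by_contra hcon
    push Not at hcon
    obtain ⟨x, hx⟩ := hcon
    choose s hs1 hs2 using hback
    let u : ℕ → {x // ∀ n, x ∈ R n} := fun n =>
      Nat.rec ⟨x, hx⟩ (fun _ p => ⟨s p.1 p.2, hs2 p.1 p.2⟩) n
    exact hfone ⟨fun n => (u n).1, fun i => hs1 (u i).1 (u i).2⟩
  have : ∀ x, DecidablePred fun n => x ∉ R n := fun x => Classical.decPred _
  refine ⟨fun x => Nat.find (hex x), measurable_find hex fun n => (hmeas n).compl, fun x => ?_⟩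
  refine (Nat.lt_find_iff _ _).2 ?_
  intro m hm
  rw [not_not]
  cases m with
  | zero => trivial
  | succ m => exact ⟨x, not_not.1 (Nat.find_min (hex x) hm), rfl⟩

/-- Greedy list coloring along a Borel map into a countable well-order in which adjacent vertices
get distinct values, when every vertex has a larger neighbor. -/
theorem exists_measurable_greedy_list_coloring {X Y K : Type*} [MeasurableSpace X]
    [MeasurableSpace Y] [StandardBorelSpace Y] [LinearOrder K] [WellFoundedLT K] [Countable K]
    (G : SimpleGraph X) (hlf : ∀ x : X, (G.neighborSet x).Finite) (g : ℕ → X → X)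
    (hg : ∀ i, Measurable (g i)) (hgG : ∀ x y, G.Adj x y ↔ ∃ i, g i x = y)
    (κ : X → K) (hκ : ∀ q, MeasurableSet {x | κ x = q})
    (hκG : ∀ x y, G.Adj x y → κ x ≠ κ y) (hlarge : ∀ x, ∃ y, G.Adj x y ∧ κ x < κ y)
    (L : X → Finset Y) (hLcard : ∀ x, (L x).card = (G.neighborSet x).ncard)
    (l : ℕ → X → Y) (hl : ∀ i, Measurable (l i)) (hlL : ∀ x y, y ∈ L x ↔ ∃ i, l i x = y) :
    ∃ c : X → Y, Measurable c ∧ (∀ x : X, c x ∈ L x) ∧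
      ∀ x y : X, G.Adj x y → c x ≠ c y := by
  classical
  have hwf : WellFounded fun x y => κ x < κ y := InvImage.wf κ wellFounded_lt
  let c : X → Y := hwf.fix fun x c =>
    l (sInf {j | ∀ y (hy : κ y < κ x), G.Adj x y → c y hy ≠ l j x}) x
  let D : X → Set ℕ := fun x => {j | ∀ y, κ y < κ x → G.Adj x y → c y ≠ l j x}
  have hc : ∀ x, c x = l (sInf (D x)) x := fun x => hwf.fix_eq _ x
  have hD : ∀ x, (D x).Nonempty := by
    intro x
    obtain ⟨z, hxz, hz⟩ := hlarge x
    let N : Finset X := (hlf x).toFinset.erase z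
    have hlt : (N.image c).card < (L x).card := by
      rw [hLcard, Set.ncard_eq_toFinset_card _ (hlf x)]
      exact Finset.card_image_le.trans_lt (Finset.card_erase_lt_of_mem (by simpa using hxz))
    obtain ⟨y, hy, hyN⟩ := Finset.exists_mem_notMem_of_card_lt_card hlt
    obtain ⟨j, rfl⟩ := (hlL x y).1 hy
    refine ⟨j, fun w hw hxw heq => hyN (Finset.mem_image.2 ⟨w, ?_, heq⟩)⟩
    simp only [N, Finset.mem_erase, Set.Finite.mem_toFinset, SimpleGraph.mem_neighborSet]
    exact ⟨fun h => (hw.trans (h ▸ hz)).false, hxw⟩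
  have hlower : ∀ x y, G.Adj x y → κ y < κ x → c x ≠ c y := fun x y hxy hlt heq =>
    Nat.sInf_mem (hD x) y hlt hxy (heq.symm.trans (hc x))
  have hlevel : ∀ q B, MeasurableSet B → MeasurableSet ({x | κ x = q} ∩ c ⁻¹' B) := by
    intro q
    induction q using WellFoundedLT.induction with
    | ind q ih =>
    intro B hB
    have hκlt : MeasurableSet {x | κ x < q} := by
      have : {x | κ x < q} = ⋃ p : Set.Iio q, {x | κ x = p} := by
        ext x; simp
      rw [this]
      exact .iUnion fun p => hκ p
    have hclt : ∀ j i, MeasurableSet {x | κ (g i x) < q ∧ c (g i x) = l j x} := by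
      intro j i
      let c' : X → Y := fun x => if κ x < q then c x else l 0 x
      have hc' : Measurable c' := by
        intro A hA
        have : c' ⁻¹' A = (⋃ p : Set.Iio q, {x | κ x = p} ∩ c ⁻¹' A) ∪
            ({x | κ x < q}ᶜ ∩ l 0 ⁻¹' A) := by
          ext x
          by_cases hx : κ x < q <;> simp [c', hx]
        rw [this]
        exact (MeasurableSet.iUnion fun p : Set.Iio q => ih p p.2 A hA).union (hκlt.compl.inter (hl 0 hA))
      have : {x | κ (g i x) < q ∧ c (g i x) = l j x} =
          g i ⁻¹' {x | κ x < q} ∩ {x | c' (g i x) = l j x} := by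
        ext x
        by_cases hx : κ (g i x) < q <;> simp [c', hx]
      rw [this]
      exact (hg i hκlt).inter (measurableSet_eq_fun (hc'.comp (hg i)) (hl j))
    let E : ℕ → Set X := fun j => ⋂ i, {x | κ (g i x) < q ∧ c (g i x) = l j x}ᶜ
    have hE : ∀ j, MeasurableSet (E j) := fun j => .iInter fun i => (hclt j i).compl
    have hED : ∀ x, κ x = q → ∀ j, x ∈ E j ↔ j ∈ D x := by
      rintro x rfl j
      simp only [E, D, Set.mem_iInter, Set.mem_compl_iff, Set.mem_ofPred_eq, not_and, hgG]
      constructor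
      · rintro h y hy ⟨i, rfl⟩
        exact h i hy
      · exact fun h i hi => h _ hi ⟨i, rfl⟩
    have heq : {x | κ x = q} ∩ c ⁻¹' B =
        ⋃ j, {x | κ x = q} ∩ (E j ∩ ((⋂ k : Fin j, (E k)ᶜ) ∩ l j ⁻¹' B)) := by
      ext x
      simp only [Set.mem_inter_iff, Set.mem_iUnion, Set.mem_ofPred_eq, Set.mem_preimage,
        Set.mem_iInter, Set.mem_compl_iff]
      constructor
      · rintro ⟨hx, hB⟩
        refine ⟨sInf (D x), hx, (hED x hx _).2 (Nat.sInf_mem (hD x)), fun k hk => ?_, hc x ▸ hB⟩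
        exact Nat.notMem_of_lt_sInf k.2 ((hED x hx _).1 hk)
      · rintro ⟨j, hx, hj, hk, hB⟩
        refine ⟨hx, ?_⟩
        have hj' : sInf (D x) = j := by
          refine le_antisymm (Nat.sInf_le ((hED x hx j).1 hj)) (not_lt.1 fun hlt => ?_)
          exact hk ⟨_, hlt⟩ ((hED x hx _).2 (Nat.sInf_mem (hD x)))
        rw [hc, hj']
        exact hB
    rw [heq]
    exact .iUnion fun j => (hκ q).inter
      ((hE j).inter ((MeasurableSet.iInter fun k : Fin j => (hE k).compl).inter (hl j hB)))
  refine ⟨c, fun B hB => ?_, fun x => (hlL x _).2 ⟨_, (hc x).symm⟩, fun x y hxy => ?_⟩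
  · have : c ⁻¹' B = ⋃ q, {x | κ x = q} ∩ c ⁻¹' B := by
      ext x; simp
    rw [this]
    exact .iUnion fun q => hlevel q B hB
  · rcases lt_or_gt_of_ne (hκG x y hxy) with h | h
    · exact (hlower y x hxy.symm h).symm
    · exact hlower x y hxy h

theorem stmt_16 {X : Type*} [MeasurableSpace X] [StandardBorelSpace X]
    (G : SimpleGraph X) (hGmeas : MeasurableSet {p : X × X | G.Adj p.1 p.2})
    (hlf : ∀ x : X, (G.neighborSet x).Finite)
    (f : X → X) (hf : Measurable f)
    (hfG : ∀ x : X, G.Adj x (f x))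
    (hfone : ¬ ∃ u : ℕ → X, ∀ i : ℕ, f (u (i + 1)) = u i)
    (Y : Type*) [TopologicalSpace Y] [MeasurableSpace Y] [PolishSpace Y] [BorelSpace Y]
    (L : X → Finset Y)
    (hLmeas : ∀ U : Set Y, IsOpen U → MeasurableSet {x : X | ∃ y ∈ L x, y ∈ U})
    (hLcard : ∀ x : X, (L x).card = (G.neighborSet x).ncard) :
    ∃ c : X → Y, Measurable c ∧ (∀ x : X, c x ∈ L x) ∧
      ∀ x y : X, G.Adj x y → c x ≠ c y := by
  have hdeg : ∀ x, (hlf x).toFinset.card = (L x).card := fun x => by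
    rw [hLcard, Set.ncard_eq_toFinset_card _ (hlf x)]
  have hcard := measurableSet_card_finset_eq L hLmeas
  have hne : ∀ x, (hlf x).toFinset.Nonempty := fun x => ⟨f x, by simpa using hfG x⟩
  obtain ⟨g, hg, hgG⟩ := exists_measurable_enumeration (fun x => (hlf x).toFinset)
    (by simpa using hGmeas) (fun k => by simpa only [hdeg] using hcard k) hne
  obtain ⟨l, hl, hlL⟩ := exists_measurable_enumeration L (measurableSet_graph_finset L hLmeas) hcard
    fun x => Finset.card_pos.1 (hdeg x ▸ Finset.card_pos.2 (hne x))
  replace hgG : ∀ x y, G.Adj x y ↔ ∃ i, g i x = y := fun x y => by simpa using hgG x y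
  obtain ⟨h, hh, hhG⟩ := exists_measurable_nat_coloring_s16 G hlf g hg hgG
  obtain ⟨r, hr, hrf⟩ := exists_measurable_rank G hlf g hg hgG f hf hfG hfone
  have : Countable (ℕ ×ₗ ℕ) := inferInstanceAs (Countable (ℕ × ℕ))
  refine exists_measurable_greedy_list_coloring G hlf g hg hgG
    (fun x => toLex (r x, h x)) (fun q => ?_) (fun x y hxy heq => ?_)
    (fun x => ⟨f x, hfG x, Prod.Lex.toLex_lt_toLex.2 (.inl (hrf x))⟩) L hLcard l hl hlL
  · exact (hr.prodMk hh) (measurableSet_singleton (ofLex q))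
  · exact hhG x y hxy (congrArg (fun p => (ofLex p).2) heq)
end

section
/- Let G be a Borel graph on a standard Borel space X with all vertex degrees at most d, where d ≥ 3 is a natural number, and suppose G contains no complete subgraph on d+1 vertices (i.e. no d+1 pairwise adjacent vertices). Then for every Borel probability measure μ on X there is a μ-measurable set A ⊆ X (measurable with respect to the completion of μ) such that A is a maximal G-independent set and A meets every set of d pairwise adjacent vertices of G. -/
open MeasureTheory

/-- Selection of an index from a countable family of measurable predicates. -/
lemma exists_measurable_index {α J : Type*} [MeasurableSpace α] [Countable J] [Nonempty J]
    (Q : α → J → Prop) (hQ : ∀ j, MeasurableSet {x | Q x j}) :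
    ∃ f : α → J, (∀ j, MeasurableSet {x | f x = j}) ∧ ∀ x, (∃ j, Q x j) → Q x (f x) := by
  classical
  obtain ⟨e, he⟩ := exists_injective_nat J
  have j₀ : J := Classical.arbitrary J
  let Q' : α → ℕ → Prop := fun x n => (∃ j, e j = n ∧ Q x j) ∨ (n = e j₀ ∧ ∀ j, ¬ Q x j)
  have hex : ∀ x, ∃ n, Q' x n := fun x => by
    by_cases h : ∃ j, Q x j
    · obtain ⟨j, hj⟩ := h
      exact ⟨e j, Or.inl ⟨j, rfl, hj⟩⟩
    · exact ⟨e j₀, Or.inr ⟨rfl, not_exists.1 h⟩⟩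
  have hmeas : ∀ n, MeasurableSet {x | Q' x n} := fun n => by
    have : {x | Q' x n} = (⋃ j, {x | e j = n} ∩ {x | Q x j}) ∪
        ({x | n = e j₀} ∩ ⋂ j, {x | Q x j}ᶜ) := by
      ext x; simp [Q']
    rw [this]
    exact (MeasurableSet.iUnion fun j => (MeasurableSet.const _).inter (hQ j)).union
      ((MeasurableSet.const _).inter (MeasurableSet.iInter fun j => (hQ j).compl))
  have hF : Measurable fun x => Nat.find (hex x) := measurable_find hex hmeas
  have hsurj : ∀ x, ∃ j, e j = Nat.find (hex x) := fun x => by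
    rcases Nat.find_spec (hex x) with ⟨j, hj, -⟩ | ⟨hj, -⟩
    · exact ⟨j, hj⟩
    · exact ⟨j₀, hj.symm⟩
  choose f hf using hsurj
  refine ⟨f, fun j => ?_, fun x ⟨j, hj⟩ => ?_⟩
  · have : {x | f x = j} = (fun x => Nat.find (hex x)) ⁻¹' {e j} := by
      ext x
      simp only [Set.mem_ofPred_eq, Set.mem_preimage, Set.mem_singleton_iff, ← hf x, he.eq_iff]
    rw [this]
    exact hF (measurableSet_singleton _)
  · rcases Nat.find_spec (hex x) with ⟨j', hj', hQ'⟩ | ⟨-, h⟩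
    · rw [← hf x, he.eq_iff] at hj'
      rwa [← hj']
    · exact absurd hj (h j)

lemma measurable_comp_index {α β J : Type*} [MeasurableSpace α] [MeasurableSpace β] [Countable J]
    {m : J → α → β} (hm : ∀ j, Measurable (m j)) {f : α → J}
    (hf : ∀ j, MeasurableSet {x | f x = j}) : Measurable fun x => m (f x) x := by
  intro s hs
  have : (fun x => m (f x) x) ⁻¹' s = ⋃ j, {x | f x = j} ∩ m j ⁻¹' s := by
    ext x; simp
  rw [this]
  exact MeasurableSet.iUnion fun j => (hf j).inter (hm j hs)

/-- A countable measurable coloring of the graph spanned by finitely many measurable maps. -/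
lemma exists_measurable_nat_coloring_s19 {V I : Type*} [MeasurableSpace V]
    [MeasurableSpace.CountablySeparated V] [Finite I] (g : I → V → V)
    (hg : ∀ i, Measurable (g i)) :
    ∃ c : V → ℕ, Measurable c ∧ ∀ i x, g i x ≠ x → c (g i x) ≠ c x := by
  obtain ⟨φ, hφ, hinj⟩ := MeasurableSpace.measurable_injection_nat_bool_of_countablySeparated V
  have hφn : ∀ n, Measurable fun x => φ x n := fun n => (measurable_pi_apply n).comp hφ
  have hsel : ∀ i, ∃ f : V → ℕ, (∀ n, MeasurableSet {x | f x = n}) ∧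
      ∀ x, (∃ n, φ x n ≠ φ (g i x) n) → φ x (f x) ≠ φ (g i x) (f x) := fun i =>
    exists_measurable_index _ fun n =>
      (measurableSet_eq_fun (hφn n) ((hφn n).comp (hg i))).compl
  choose f hf hfs using hsel
  have hfm : ∀ i, Measurable (f i) := fun i => measurable_to_countable' fun n => hf i n
  obtain ⟨e, he⟩ := exists_injective_nat (I → ℕ × Bool)
  refine ⟨fun x => e fun i => (f i x, φ x (f i x)), ?_, fun i x hne heq => ?_⟩
  · refine (Measurable.of_discrete (f := e)).comp (measurable_pi_lambda _ fun i => ?_)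
    exact (hfm i).prodMk (measurable_comp_index hφn (hf i))
  · have h := congrFun (he heq) i
    simp only [Prod.mk.injEq] at h
    have hne' : ∃ n, φ x n ≠ φ (g i x) n := by
      by_contra! hcon
      exact hne (hinj (funext hcon)).symm
    apply hfs i x hne'
    rw [← h.2, h.1]

/-- The graph spanned by finitely many measurable maps has a finite measurable coloring. -/
lemma exists_measurable_fin_coloring {V I : Type*} [MeasurableSpace V]
    [MeasurableSpace.CountablySeparated V] [Fintype I] (g : I → V → V)
    (hg : ∀ i, Measurable (g i)) (hsymm : ∀ i x, ∃ j, g j (g i x) = x) :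
    ∃ c : V → Fin (Fintype.card I + 1), Measurable c ∧ ∀ i x, g i x ≠ x → c (g i x) ≠ c x := by
  classical
  obtain ⟨c, hc, hcne⟩ := exists_measurable_nat_coloring_s19 g hg
  have hmex : ∀ h : I → Fin (Fintype.card I + 1), ∃ k, ∀ i, h i ≠ k := fun h => by
    by_contra! hcon
    have := Fintype.card_le_of_surjective h hcon
    simp at this
  choose m hm using hmex
  let C : ℕ → V → Fin (Fintype.card I + 1) := fun n => Nat.rec (fun _ => 0)
    (fun n Cn x => if c x = n then m (fun i => Cn (g i x)) else Cn x) n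
  have hC : ∀ n x, C (n + 1) x = if c x = n then m (fun i => C n (g i x)) else C n x :=
    fun _ _ => rfl
  have hCm : ∀ n, Measurable (C n) := fun n => by
    induction n with
    | zero => exact measurable_const
    | succ n ih =>
      refine Measurable.ite (hc (measurableSet_singleton n)) ?_ ih
      exact (Measurable.of_discrete (f := m)).comp
        (measurable_pi_lambda _ fun i => ih.comp (hg i))
  have hstable : ∀ x n, c x < n → C n x = C (c x + 1) x := fun x n hn => by
    induction n, hn using Nat.le_induction with
    | base => rfl
    | succ n hn ih =>
      rw [hC n, if_neg (by simp at hn; omega), ih]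
  have hlt : ∀ i x, c (g i x) < c x → C (c (g i x) + 1) (g i x) ≠ C (c x + 1) x := by
    intro i x hlt
    rw [hC (c x), if_pos rfl, ← hstable _ _ hlt]
    exact hm (fun i => C (c x) (g i x)) i
  refine ⟨fun x => C (c x + 1) x, ?_, fun i x hne => ?_⟩
  · exact measurable_comp_index (m := fun n => C (n + 1)) (fun n => hCm (n + 1))
      (fun n => hc (measurableSet_singleton n))
  · rcases lt_or_gt_of_ne (hcne i x hne) with h | h
    · exact hlt i x h
    · obtain ⟨j, hj⟩ := hsymm i x
      have := hlt j (g i x)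
      rw [hj] at this
      exact (this h).symm

/-- Every finite measure is absolutely continuous with respect to a finite measure that is
quasi-preserved by a given finite family of measurable maps. -/
lemma exists_quasiMeasurePreserving {X I : Type*} [MeasurableSpace X] [Finite I]
    (g : I → X → X) (hg : ∀ i, Measurable (g i)) (μ : Measure X) [IsFiniteMeasure μ] :
    ∃ ν : Measure X, IsFiniteMeasure ν ∧ μ ≪ ν ∧ ∀ i, Measure.QuasiMeasurePreserving (g i) ν ν := by
  let w : List I → X → X := fun l => l.foldr (fun i f => g i ∘ f) id
  have hw : ∀ l, Measurable (w l) := fun l => by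
    induction l with
    | nil => exact measurable_id
    | cons i l ih => exact (hg i).comp ih
  let κ : Measure X := Measure.sum fun l => μ.map (w l)
  refine ⟨κ.toFinite, inferInstance, ?_, fun i => ⟨hg i, ?_⟩⟩
  · refine Measure.AbsolutelyContinuous.trans ?_ (absolutelyContinuous_toFinite κ)
    refine Measure.AbsolutelyContinuous.mk fun s hs h0 => ?_
    rw [Measure.sum_apply_eq_zero' hs] at h0
    simpa [w] using h0 []
  · refine Measure.AbsolutelyContinuous.mk fun s hs h0 => ?_
    rw [Measure.map_apply (hg i) hs]
    rw [toFinite_apply_eq_zero_iff] at h0 ⊢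
    rw [Measure.sum_apply_eq_zero' hs] at h0
    rw [Measure.sum_apply_eq_zero' (hg i hs)]
    intro l
    have := h0 (i :: l)
    rw [Measure.map_apply (hw _) hs] at this
    rwa [Measure.map_apply (hw _) (hg i hs)]

/-- A port system on `V` has three ports at each `v : V`, and an involution `κ` of the ports
linking ports in pairs (fixed ports are free). A solution selects a port at each `v` in such a way
that ports selected at distinct points are never linked. -/
def PortSolution {V : Type*} (κ : V × Fin 3 → V × Fin 3) (s : V → Fin 3) : Prop :=
  ∀ v w, κ (v, s v) = (w, s w) → v = w

lemma exists_portSolution {V : Type*} {κ : V × Fin 3 → V × Fin 3} (hκ : Function.Involutive κ) :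
    ∃ s, PortSolution κ s := by
  classical
  let L : V × Fin 3 → Sym2 (V × Fin 3) := fun p => s(p, κ p)
  let t : V → Finset (Sym2 (V × Fin 3)) := fun v => Finset.univ.image fun i => L (v, i)
  have hall : ∀ S : Finset V, S.card ≤ (S.biUnion t).card := fun S => by
    have hle := Finset.card_le_mul_card_image (f := L) (S ×ˢ (Finset.univ : Finset (Fin 3))) 2
      fun b _ => by
        induction b with
        | _ p q =>
          refine (Finset.card_le_card (t := {p, q}) fun x hx => ?_).trans Finset.card_le_two
          have : x ∈ s(p, q) := by
            rw [← (Finset.mem_filter.1 hx).2]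
            exact Sym2.mem_mk_left _ _
          simpa using this
    have himg : (S ×ˢ (Finset.univ : Finset (Fin 3))).image L ⊆ S.biUnion t := fun x hx => by
      obtain ⟨⟨v, i⟩, hv, rfl⟩ := Finset.mem_image.1 hx
      exact Finset.mem_biUnion.2 ⟨v, (Finset.mem_product.1 hv).1,
        Finset.mem_image.2 ⟨i, Finset.mem_univ _, rfl⟩⟩
    have := Finset.card_le_card himg
    rw [Finset.card_product, Finset.card_univ, Fintype.card_fin] at hle
    omega
  obtain ⟨f, hf, hft⟩ := (Finset.all_card_le_biUnion_card_iff_exists_injective t).1 hall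
  choose s hs using fun v => Finset.mem_image.1 (hft v)
  refine ⟨s, fun v w h => hf ?_⟩
  have h' : κ (w, s w) = (v, s v) := by rw [← h, hκ]
  rw [← (hs v).2, ← (hs w).2]
  simp only [L, h, h']
  exact Sym2.eq_swap

/-- Data for the simultaneous reduction of a port system around a set `A` of centers, no two of
which are at distance at most two. -/
structure ContractionData (V : Type*) where
  /-- the linking involution -/
  κ : V × Fin 3 → V × Fin 3
  /-- the centers -/
  A : Set V
  /-- the port through which a center settles a neighbour -/
  a : Fin 3
  /-- the port of a settled point which leads to its center -/
  bw : V → Fin 3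
  /-- the port of a merged point which leads to its center -/
  bu : V → Fin 3
  invol : Function.Involutive κ
  sep₁ : ∀ v ∈ A, ∀ b, (κ (v, b)).1 ∈ A → (κ (v, b)).1 = v
  sep₂ : ∀ v ∈ A, ∀ b b', (κ ((κ (v, b)).1, b')).1 ∈ A → (κ ((κ (v, b)).1, b')).1 = v
  bw_spec : ∀ x b, (κ (x, b)).1 ∈ A → (κ (x, b)).2 = a →
    (κ (x, bw x)).1 ∈ A ∧ (κ (x, bw x)).2 = a
  bu_spec : ∀ x b, (κ (x, b)).1 ∈ A → (κ (x, b)).2 = a + 1 →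
    (κ (x, bu x)).1 ∈ A ∧ (κ (x, bu x)).2 = a + 1

namespace ContractionData

variable {V : Type*} (D : ContractionData V)

/-- The points reached from a center through the port `a`. -/
def settled : Set V := {x | (D.κ (x, D.bw x)).1 ∈ D.A ∧ (D.κ (x, D.bw x)).2 = D.a}

/-- The points whose port `a + 1` leads back to the point or to the neighbour through `a`. -/
def degenerate : Set V :=
  {v | (D.κ (v, D.a + 1)).1 = v ∨ (D.κ (v, D.a + 1)).1 = (D.κ (v, D.a)).1}

/-- The centers that are merged with their neighbour through the port `a + 1`. -/
def proper : Set V := (D.A ∩ D.settledᶜ) ∩ D.degenerateᶜ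

/-- The center linked with a merged point. -/
def center (x : V) : V := (D.κ (x, D.bu x)).1

/-- The points that are merged into a proper center. -/
def merged : Set V := {x | D.center x ∈ D.proper ∧ (D.κ (x, D.bu x)).2 = D.a + 1}

/-- The points whose selected port does not depend on a solution of the reduced system. -/
def decided : Set V := D.settled ∪ (D.A ∩ D.degenerate)

/-- The points that have no linked port in the reduced system. -/
def dead : Set V := D.decided ∪ D.merged

open Classical in
/-- The exchange of the two disappearing ports of each proper center with the two outer ports of
the point merged into it. -/
noncomputable def exchange (p : V × Fin 3) : V × Fin 3 :=
  if p.1 ∈ D.proper then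
    if p.2 = D.a then ((D.κ (p.1, D.a + 1)).1, (D.κ (p.1, D.a + 1)).2 + 1)
    else if p.2 = D.a + 1 then ((D.κ (p.1, D.a + 1)).1, (D.κ (p.1, D.a + 1)).2 + 2)
    else p
  else if p.1 ∈ D.merged then
    if p.2 = D.bu p.1 + 1 then (D.center p.1, D.a)
    else if p.2 = D.bu p.1 + 2 then (D.center p.1, D.a + 1)
    else p
  else p

open Classical in
/-- The linking involution of the reduced system. -/
noncomputable def reducedLink (p : V × Fin 3) : V × Fin 3 :=
  if p.1 ∈ D.dead ∨ (D.exchange (D.κ (D.exchange p))).1 ∈ D.dead then p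
  else D.exchange (D.κ (D.exchange p))

open Classical in
/-- The point of the reduced system controlling `x`. -/
noncomputable def target (x : V) : V := if x ∈ D.merged then D.center x else x

open Classical in
/-- The port selected at `x`, in terms of the port selected at the target of `x`. -/
noncomputable def lift (x : V) (i : Fin 3) : Fin 3 :=
  if x ∈ D.settled then D.bw x
  else if x ∈ D.A then
    if x ∈ D.degenerate then D.a + 1
    else if i = D.a + 2 then D.a + 2 else D.a + 1
  else if x ∈ D.merged then
    if i = D.a then D.bu x + 1
    else if i = D.a + 1 then D.bu x + 2
    else D.bu x
  else i

lemma mem_settled_of_link {v x : V} {b : Fin 3} (hv : v ∈ D.A) (h : D.κ (v, D.a) = (x, b)) :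
    x ∈ D.settled := by
  have h' : D.κ (x, b) = (v, D.a) := by rw [← h, D.invol]
  exact D.bw_spec x b (by rwa [h']) (by rw [h'])

lemma center_link {x : V} (hx : x ∈ D.merged) :
    D.κ (D.center x, D.a + 1) = (x, D.bu x) := by
  have : D.κ (x, D.bu x) = (D.center x, D.a + 1) := Prod.ext rfl hx.2
  rw [← this, D.invol]

lemma merged_of_proper {v : V} (hv : v ∈ D.proper) :
    (D.κ (v, D.a + 1)).1 ∈ D.merged ∧ D.center (D.κ (v, D.a + 1)).1 = v ∧
      D.bu (D.κ (v, D.a + 1)).1 = (D.κ (v, D.a + 1)).2 := by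
  set x := (D.κ (v, D.a + 1)).1 with hx
  have hxv : D.κ (x, (D.κ (v, D.a + 1)).2) = (v, D.a + 1) := D.invol _
  have hu := D.bu_spec x _ (by rw [hxv]; exact hv.1.1) (by rw [hxv])
  have hc : D.center x = v := D.sep₂ v hv.1.1 (D.a + 1) (D.bu x) hu.1
  refine ⟨⟨by rwa [hc], hu.2⟩, hc, ?_⟩
  have h : D.κ (x, D.bu x) = (v, D.a + 1) := Prod.ext hc hu.2
  exact congrArg Prod.snd (D.invol.injective (h.trans hxv.symm))

lemma notMem_A_of_merged {x : V} (hx : x ∈ D.merged) : x ∉ D.A := fun hA => by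
  have h := D.center_link hx
  have := D.sep₁ _ hx.1.1.1 (D.a + 1) (by rwa [h])
  exact hx.1.2 (Or.inl this)

lemma notMem_settled_of_merged {x : V} (hx : x ∈ D.merged) : x ∉ D.settled := fun hS => by
  have h := D.center_link hx
  have hv := D.sep₂ _ hx.1.1.1 (D.a + 1) (D.bw x) (by rw [h]; exact hS.1)
  rw [h] at hv
  have hl : D.κ (x, D.bw x) = (D.center x, D.a) := Prod.ext hv hS.2
  refine hx.1.2 (Or.inr ?_)
  rw [h, ← hl, D.invol]

lemma notMem_proper_of_merged {x : V} (hx : x ∈ D.merged) : x ∉ D.proper :=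
  fun h => D.notMem_A_of_merged hx h.1.1

lemma add_one_ne (i : Fin 3) : i + 1 ≠ i := by decide +revert

lemma add_two_ne (i : Fin 3) : i + 2 ≠ i := by decide +revert

lemma add_two_ne_add_one (i : Fin 3) : i + 2 ≠ i + 1 := by decide +revert

lemma eq_add_two (i j : Fin 3) (h : j ≠ i) (h' : j ≠ i + 1) : j = i + 2 := by
  decide +revert

lemma exchange_involutive : Function.Involutive D.exchange := by
  rintro ⟨x, i⟩
  by_cases hx : x ∈ D.proper
  · obtain ⟨hm, hc, hb⟩ := D.merged_of_proper hx
    have hp := D.notMem_proper_of_merged hm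
    by_cases h1 : i = D.a
    · simp [exchange, hx, h1, hm, hp, hc, hb]
    · by_cases h2 : i = D.a + 1
      · simp [exchange, hx, h2, hm, hp, hc, hb]
      · simp [exchange, hx, h1, h2]
  · by_cases hm : x ∈ D.merged
    · have hc := D.center_link hm
      have hp := hm.1
      by_cases h1 : i = D.bu x + 1
      · simp [exchange, hx, h1, hm, hp, hc]
      · by_cases h2 : i = D.bu x + 2
        · simp [exchange, hx, h2, hm, hp, hc]
        · simp [exchange, hx, hm, h1, h2]
    · simp [exchange, hx, hm]

lemma reducedLink_involutive : Function.Involutive D.reducedLink := by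
  intro p
  by_cases h : p.1 ∈ D.dead ∨ (D.exchange (D.κ (D.exchange p))).1 ∈ D.dead
  · have : D.reducedLink p = p := if_pos h
    rw [this, this]
  · have h1 : D.reducedLink p = D.exchange (D.κ (D.exchange p)) := if_neg h
    have h2 : D.exchange (D.κ (D.exchange (D.exchange (D.κ (D.exchange p))))) = p := by
      rw [D.exchange_involutive, D.invol, D.exchange_involutive]
    rw [h1, reducedLink, h2, if_neg (by tauto)]

lemma lift_eq_of_mem_decided {x : V} (hx : x ∈ D.decided) (i j : Fin 3) :
    D.lift x i = D.lift x j := by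
  by_cases hs : x ∈ D.settled
  · simp [lift, hs]
  · have := hx.resolve_left hs
    simp [lift, hs, this.1, this.2]

lemma portSolution_lift {s : V → Fin 3} (hs : PortSolution D.reducedLink s) :
    PortSolution D.κ (fun x => D.lift x (s (D.target x))) := by
  set t : V → Fin 3 := fun x => D.lift x (s (D.target x)) with ht
  have ht_settled : ∀ {x}, x ∈ D.settled → t x = D.bw x := fun hx => by
    simp [ht, lift, hx]
  have ht_degenerate : ∀ {x}, x ∉ D.settled → x ∈ D.A → x ∈ D.degenerate → t x = D.a + 1 :=
    fun hx hA hd => by simp [ht, lift, hx, hA, hd]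
  have ht_proper : ∀ {x}, x ∈ D.proper → t x = if s x = D.a + 2 then D.a + 2 else D.a + 1 :=
    fun {x} hx => by
      have hm : x ∉ D.merged := fun h => D.notMem_proper_of_merged h hx
      have h1 : x ∉ D.settled := hx.1.2
      have h2 : x ∉ D.degenerate := hx.2
      simp [ht, lift, h1, hx.1.1, h2, target, hm]
  have ht_merged : ∀ {x}, x ∈ D.merged → t x = if s (D.center x) = D.a then D.bu x + 1
      else if s (D.center x) = D.a + 1 then D.bu x + 2 else D.bu x := fun hx => by
    simp [ht, lift, D.notMem_settled_of_merged hx, D.notMem_A_of_merged hx, hx, target]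
  -- a port selected at a settled point is linked to no other selected port
  have hsettled : ∀ x y, D.κ (x, t x) = (y, t y) → x ≠ y → x ∉ D.settled := by
    intro x y h hne hx
    rw [ht_settled hx] at h
    have hy : y ∈ D.A := by simpa [h] using hx.1
    have hty : t y = D.a := by simpa [h] using hx.2
    have h' : D.κ (y, D.a) = (x, D.bw x) := by rw [← hty, ← h, D.invol]
    by_cases hys : y ∈ D.settled
    · rw [ht_settled hys] at hty
      have hxA : x ∈ D.A := by simpa [hty, h'] using hys.1
      exact hne (by simpa [h'] using D.sep₁ y hy D.a (by rwa [h']))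
    · by_cases hd : y ∈ D.degenerate
      · exact add_one_ne D.a (by rw [← ht_degenerate hys hy hd, hty])
      · rw [ht_proper ⟨⟨hy, hys⟩, hd⟩] at hty
        split_ifs at hty
        · exact add_two_ne _ hty
        · exact add_one_ne _ hty
  have hclass : ∀ x, x ∈ D.settled ∨ (x ∈ D.A ∧ x ∉ D.settled ∧ t x = D.a + 1 ∧
      (x ∈ D.degenerate ∨ s x ≠ D.a + 2)) ∨
      (x ∈ D.merged ∧ t x = D.bu x ∧ s (D.center x) = D.a + 2) ∨
      ∃ z, z ∉ D.dead ∧ (x, t x) = D.exchange (z, s z) := by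
    have hdead : ∀ {v}, v ∈ D.proper → v ∉ D.dead := fun {v} hv h => by
      rcases h with (h | h) | h
      · exact hv.1.2 h
      · exact hv.2 h.2
      · exact D.notMem_proper_of_merged h hv
    intro x
    by_cases hxs : x ∈ D.settled
    · exact Or.inl hxs
    by_cases hA : x ∈ D.A
    · by_cases hd : x ∈ D.degenerate
      · exact Or.inr (Or.inl ⟨hA, hxs, ht_degenerate hxs hA hd, Or.inl hd⟩)
      · have hp : x ∈ D.proper := ⟨⟨hA, hxs⟩, hd⟩
        by_cases h2 : s x = D.a + 2
        · refine Or.inr (Or.inr (Or.inr ⟨x, hdead hp, ?_⟩))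
          simp [ht_proper hp, h2, exchange, hp]
        · refine Or.inr (Or.inl ⟨hA, hxs, ?_, Or.inr h2⟩)
          simp [ht_proper hp, h2]
    · by_cases hm : x ∈ D.merged
      · have hc := D.center_link hm
        have hp := hm.1
        by_cases h0 : s (D.center x) = D.a
        · refine Or.inr (Or.inr (Or.inr ⟨D.center x, hdead hp, ?_⟩))
          simp [ht_merged hm, h0, exchange, hp, hc]
        · by_cases h1 : s (D.center x) = D.a + 1
          · refine Or.inr (Or.inr (Or.inr ⟨D.center x, hdead hp, ?_⟩))
            simp [ht_merged hm, h1, exchange, hp, hc]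
          · refine Or.inr (Or.inr (Or.inl ⟨hm, ?_, eq_add_two _ _ h0 h1⟩))
            simp [ht_merged hm, h0, h1]
      · refine Or.inr (Or.inr (Or.inr ⟨x, ?_, ?_⟩))
        · rintro ((h | h) | h)
          · exact hxs h
          · exact hA h.1
          · exact hm h
        · have hp : x ∉ D.proper := fun h => hA h.1.1
          simp [ht, lift, hxs, hA, hm, exchange, hp, target]
  intro x y h
  by_contra hne
  have h' : D.κ (y, t y) = (x, t x) := by rw [← h, D.invol]
  have hcenter : ∀ x y, D.κ (x, t x) = (y, t y) → x ≠ y → ¬ (x ∈ D.A ∧ x ∉ D.settled ∧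
      t x = D.a + 1 ∧ (x ∈ D.degenerate ∨ s x ≠ D.a + 2)) := by
    rintro x y h hne ⟨hA, hxs, htx, hor⟩
    have h' : D.κ (y, t y) = (x, t x) := by rw [← h, D.invol]
    rw [htx] at h
    by_cases hd : x ∈ D.degenerate
    · rcases hd with hd | hd
      · rw [h] at hd
        exact hne hd.symm
      · rw [h] at hd
        exact hsettled y x h' (Ne.symm hne)
          (D.mem_settled_of_link (b := (D.κ (x, D.a)).2) hA (Prod.ext hd.symm rfl))
    · have hsx := hor.resolve_left hd
      obtain ⟨hm, hc, hb⟩ := D.merged_of_proper (v := x) ⟨⟨hA, hxs⟩, hd⟩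
      rw [h] at hm hc hb
      have hty := ht_merged hm
      rw [hc] at hty
      simp only at hb
      rw [← hb] at hty
      split_ifs at hty with h1 h2
      · exact add_one_ne _ hty.symm
      · exact add_two_ne _ hty.symm
      · exact hsx (eq_add_two _ _ h1 h2)
  have hmerged : ∀ x y, D.κ (x, t x) = (y, t y) →
      ¬ (x ∈ D.merged ∧ t x = D.bu x ∧ s (D.center x) = D.a + 2) := by
    rintro x y h ⟨hm, htx, hsc⟩
    have hc := hm.2
    have hcy : D.center x = y := by rw [center, ← htx, h]
    rw [← htx, h] at hc
    have hp := hm.1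
    rw [hcy] at hp hsc
    have := ht_proper hp
    rw [if_pos hsc] at this
    exact add_two_ne_add_one _ (this.symm.trans hc)
  obtain ⟨z, hz, hxz⟩ := (((hclass x).resolve_left (hsettled x y h hne)).resolve_left
    (hcenter x y h hne)).resolve_left (hmerged x y h)
  obtain ⟨z', hz', hyz⟩ := (((hclass y).resolve_left (hsettled y x h' (Ne.symm hne))).resolve_left
    (hcenter y x h' (Ne.symm hne))).resolve_left (hmerged y x h')
  have hl : D.exchange (D.κ (D.exchange (z, s z))) = (z', s z') := by
    rw [← hxz, h, hyz, D.exchange_involutive]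
  have : z = z' := hs z z' (by rw [reducedLink, hl, if_neg (by tauto)])
  subst this
  exact hne (congrArg Prod.fst (hxz.trans hyz.symm))

end ContractionData

namespace ContractionData

variable {V : Type*} (D : ContractionData V) [MeasurableSpace V]

/-- Contraction data all of whose components are measurable. -/
structure IsMeasurable : Prop where
  κ : Measurable D.κ
  A : MeasurableSet D.A
  bw : Measurable D.bw
  bu : Measurable D.bu

namespace IsMeasurable

variable {D} (hD : D.IsMeasurable)
include hD

lemma link {f : V → Fin 3} (hf : Measurable f) : Measurable fun x => D.κ (x, f x) :=
  hD.κ.comp (measurable_id.prodMk hf)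

lemma settled : MeasurableSet D.settled :=
  ((hD.link hD.bw).fst hD.A).inter ((hD.link hD.bw).snd (measurableSet_singleton D.a))

lemma degenerate [MeasurableEq V] : MeasurableSet D.degenerate :=
  (measurableSet_eq_fun (hD.link measurable_const).fst measurable_id).union
    (measurableSet_eq_fun (hD.link measurable_const).fst (hD.link measurable_const).fst)

lemma proper [MeasurableEq V] : MeasurableSet D.proper :=
  (hD.A.inter hD.settled.compl).inter hD.degenerate.compl

lemma center : Measurable D.center := (hD.link hD.bu).fst

lemma merged [MeasurableEq V] : MeasurableSet D.merged :=
  (hD.center hD.proper).inter ((hD.link hD.bu).snd (measurableSet_singleton (D.a + 1)))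

lemma decided [MeasurableEq V] : MeasurableSet D.decided :=
  hD.settled.union (hD.A.inter hD.degenerate)

lemma dead [MeasurableEq V] : MeasurableSet D.dead := hD.decided.union hD.merged

lemma exchange [MeasurableEq V] : Measurable D.exchange := by
  have hl : Measurable fun p : V × Fin 3 => D.κ (p.1, D.a + 1) :=
    (hD.link measurable_const).comp measurable_fst
  have hbu : Measurable fun p : V × Fin 3 => D.bu p.1 := hD.bu.comp measurable_fst
  have hc : Measurable fun p : V × Fin 3 => D.center p.1 := hD.center.comp measurable_fst
  have hadd : ∀ i : Fin 3, Measurable fun j : Fin 3 => j + i := fun i => .of_discrete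
  refine Measurable.ite (measurable_fst hD.proper)
    (Measurable.ite (measurable_snd (measurableSet_singleton _))
      (hl.fst.prodMk ((hadd 1).comp hl.snd))
      (Measurable.ite (measurable_snd (measurableSet_singleton _))
        (hl.fst.prodMk ((hadd 2).comp hl.snd)) measurable_id))
    (Measurable.ite (measurable_fst hD.merged)
      (Measurable.ite (measurableSet_eq_fun measurable_snd ((hadd 1).comp hbu))
        (hc.prodMk measurable_const)
        (Measurable.ite (measurableSet_eq_fun measurable_snd ((hadd 2).comp hbu))
          (hc.prodMk measurable_const) measurable_id)) measurable_id)

lemma reducedLink [MeasurableEq V] : Measurable D.reducedLink := by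
  have h : Measurable fun p => D.exchange (D.κ (D.exchange p)) :=
    hD.exchange.comp (hD.κ.comp hD.exchange)
  exact Measurable.ite ((measurable_fst hD.dead).union (h.fst hD.dead)) measurable_id h

lemma target [MeasurableEq V] : Measurable D.target :=
  Measurable.ite hD.merged hD.center measurable_id

lemma lift [MeasurableEq V] (i : Fin 3) : Measurable fun x => D.lift x i := by
  have hadd : ∀ i : Fin 3, Measurable fun j : Fin 3 => j + i := fun i => .of_discrete
  refine Measurable.ite hD.settled hD.bw (Measurable.ite hD.A (Measurable.ite hD.degenerate
    measurable_const (Measurable.ite (.const _) measurable_const measurable_const))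
    (Measurable.ite hD.merged (Measurable.ite (.const _) ((hadd 1).comp hD.bu)
      (Measurable.ite (.const _) ((hadd 2).comp hD.bu) hD.bu)) measurable_const))

end IsMeasurable

/-- Measurable contraction data settling a fixed proportion of the space exist. -/
lemma exists_isMeasurable [StandardBorelSpace V] {κ : V × Fin 3 → V × Fin 3}
    (hκ : Function.Involutive κ) (hm : Measurable κ) (μ : Measure V) :
    ∃ D : ContractionData V, D.κ = κ ∧ D.IsMeasurable ∧
      μ Set.univ ≤ 39 * μ D.settled := by
  have hb : ∀ b : Fin 3, Measurable fun x => κ (x, b) := fun b =>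
    hm.comp (measurable_id.prodMk measurable_const)
  let g : Fin 3 ⊕ Fin 3 × Fin 3 → V → V :=
    Sum.elim (fun b x => (κ (x, b)).1) fun b x => (κ ((κ (x, b.1)).1, b.2)).1
  have hg : ∀ i, Measurable (g i) := by
    rintro (b | ⟨b, b'⟩)
    · exact (hb b).fst
    · exact (hb b').fst.comp (hb b).fst
  obtain ⟨c, hc, hcne⟩ := exists_measurable_fin_coloring g hg (by
    rintro (b | ⟨b, b'⟩) x
    · exact ⟨.inl (κ (x, b)).2, by simp [g, hκ (x, b)]⟩
    · refine ⟨.inr ((κ ((κ (x, b)).1, b')).2, (κ (x, b)).2), ?_⟩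
      simp [g, hκ ((κ (x, b)).1, b'), hκ (x, b)])
  let W : Fin (Fintype.card (Fin 3 ⊕ Fin 3 × Fin 3) + 1) × Fin 3 → Set V := fun p =>
    {x | c (κ (x, 0)).1 = p.1 ∧ (κ (x, 0)).2 = p.2}
  obtain ⟨p, -, hp⟩ := Finset.exists_max_image Finset.univ (fun p => μ (W p))
    ⟨0, Finset.mem_univ _⟩
  have hW : μ Set.univ ≤ 39 * μ (W p) := calc
    μ Set.univ ≤ μ (⋃ q, W q) :=
      measure_mono fun x _ => Set.mem_iUnion.2 ⟨(c (κ (x, 0)).1, (κ (x, 0)).2), rfl, rfl⟩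
    _ ≤ ∑ q, μ (W q) := measure_iUnion_fintype_le _ _
    _ ≤ ∑ _q : Fin (Fintype.card (Fin 3 ⊕ Fin 3 × Fin 3) + 1) × Fin 3, μ (W p) :=
      Finset.sum_le_sum fun q hq => hp q hq
    _ = 39 * μ (W p) := by simp
  let A : Set V := {x | c x = p.1}
  have hA : MeasurableSet A := hc (measurableSet_singleton _)
  have hsel : ∀ a : Fin 3, ∃ f : V → Fin 3, (∀ b, MeasurableSet {x | f x = b}) ∧
      ∀ x, (∃ b, (κ (x, b)).1 ∈ A ∧ (κ (x, b)).2 = a) →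
        (κ (x, f x)).1 ∈ A ∧ (κ (x, f x)).2 = a := fun a =>
    exists_measurable_index _ fun b =>
      ((hb b).fst hA).inter ((hb b).snd (measurableSet_singleton a))
  choose f hf hfs using hsel
  have hfm : ∀ a, Measurable (f a) := fun a => measurable_to_countable' fun b => hf a b
  refine ⟨⟨κ, A, p.2, f p.2, f (p.2 + 1), hκ, fun v hv b hvb => ?_, fun v hv b b' hvb => ?_,
    fun x b h h' => hfs _ x ⟨b, h, h'⟩, fun x b h h' => hfs _ x ⟨b, h, h'⟩⟩, rfl,
    ⟨hm, hA, hfm _, hfm _⟩, hW.trans ?_⟩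
  · by_contra hne
    exact hcne (.inl b) v hne (hvb.trans hv.symm)
  · by_contra hne
    exact hcne (.inr (b, b')) v hne (hvb.trans hv.symm)
  · gcongr
    exact fun x hx => hfs _ x ⟨0, hx⟩

end ContractionData

/-- A port system that controls the port system `κ₀`. -/
structure Reduction {V : Type*} [MeasurableSpace V] (κ₀ : V × Fin 3 → V × Fin 3) where
  /-- the linking involution of the controlling system -/
  κ : V × Fin 3 → V × Fin 3
  /-- the controlling point -/
  target : V → V
  /-- the selected port in terms of the port selected at the controlling point -/
  lift : V → Fin 3 → Fin 3
  /-- the points where the selected port is not yet determined -/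
  active : Set V
  invol : Function.Involutive κ
  measurable_κ : Measurable κ
  measurable_target : Measurable target
  measurable_lift : ∀ i, Measurable fun v => lift v i
  measurableSet_active : MeasurableSet active
  lift_eq : ∀ v ∉ active, ∀ i j, lift v i = lift v j
  sol : ∀ s, PortSolution κ s → PortSolution κ₀ fun v => lift v (s (target v))

lemma Reduction.exists_next {V : Type*} [MeasurableSpace V] [StandardBorelSpace V]
    {κ₀ : V × Fin 3 → V × Fin 3} (μ : Measure V) [IsFiniteMeasure μ] (S : Reduction κ₀) :
    ∃ S' : Reduction κ₀, S'.active ⊆ S.active ∧ μ S'.active ≤ 38 / 39 * μ S.active ∧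
      ∀ v ∉ S.active, ∀ i, S'.lift v i = S.lift v i := by
  obtain ⟨D, hDκ, hD, hμ⟩ := ContractionData.exists_isMeasurable S.invol S.measurable_κ
    ((μ.restrict S.active).map S.target)
  rw [Measure.map_apply S.measurable_target .univ,
    Measure.map_apply S.measurable_target hD.settled, Set.preimage_univ,
    Measure.restrict_apply_univ, Measure.restrict_apply (S.measurable_target hD.settled)] at hμ
  refine ⟨⟨D.reducedLink, D.target ∘ S.target, fun v i => S.lift v (D.lift (S.target v) i),
    S.active ∩ S.target ⁻¹' D.decidedᶜ, D.reducedLink_involutive, hD.reducedLink,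
    hD.target.comp S.measurable_target, fun i => ?_,
    S.measurableSet_active.inter (S.measurable_target hD.decided.compl), fun v hv i j => ?_,
    fun s hs => ?_⟩, Set.inter_subset_left, ?_, fun v hv i => S.lift_eq v hv _ _⟩
  · exact measurable_comp_index (m := fun i v => S.lift v i) S.measurable_lift
      fun j => (hD.lift i).comp S.measurable_target (measurableSet_singleton j)
  · by_cases h : v ∈ S.active
    · have hd : S.target v ∈ D.decided := by
        by_contra hd
        exact hv ⟨h, hd⟩
      rw [D.lift_eq_of_mem_decided hd i j]
    · exact S.lift_eq v h _ _
  · have := D.portSolution_lift hs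
    rw [hDκ] at this
    exact S.sol _ this
  · have hadd : μ (S.active ∩ S.target ⁻¹' D.decidedᶜ) + μ (S.target ⁻¹' D.settled ∩ S.active)
        ≤ μ S.active := by
      rw [← measure_union _ ((S.measurable_target hD.settled).inter S.measurableSet_active)]
      · exact measure_mono (Set.union_subset Set.inter_subset_left Set.inter_subset_right)
      · exact Set.disjoint_left.2 fun v h h' => h.2 (Or.inl h'.1)
    have h1 := measure_ne_top μ S.active
    have h2 := measure_ne_top μ (S.active ∩ S.target ⁻¹' D.decidedᶜ)
    have h3 := measure_ne_top μ (S.target ⁻¹' D.settled ∩ S.active)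
    rw [← ENNReal.toReal_le_toReal (by finiteness) h1, ENNReal.toReal_add h2 h3] at hadd
    rw [← ENNReal.toReal_le_toReal h1 (by finiteness), ENNReal.toReal_mul] at hμ
    rw [← ENNReal.toReal_le_toReal h2 (ENNReal.mul_ne_top (ENNReal.div_ne_top (by simp)
      (by simp)) h1), ENNReal.toReal_mul, ENNReal.toReal_div]
    simp only [Set.preimage_compl] at hadd ⊢
    norm_num at hμ hadd ⊢
    linarith

/-- Every measurable port system has a measurable solution up to a null set. -/
theorem exists_nullMeasurableSet_portSolution {V : Type*} [MeasurableSpace V]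
    [StandardBorelSpace V] {κ : V × Fin 3 → V × Fin 3} (hκ : Function.Involutive κ)
    (hm : Measurable κ) (μ : Measure V) [IsFiniteMeasure μ] :
    ∃ s, PortSolution κ s ∧ ∀ i, NullMeasurableSet {v | s v = i} μ := by
  let S₀ : Reduction κ := ⟨κ, id, fun _ i => i, Set.univ, hκ, hm, measurable_id,
    fun _ => measurable_const, .univ, fun v hv => absurd (Set.mem_univ v) hv, fun s hs => hs⟩
  choose F hFsub hFμ hFlift using Reduction.exists_next (κ₀ := κ) μ
  let S : ℕ → Reduction κ := fun n => F^[n] S₀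
  have hS : ∀ n, S (n + 1) = F (S n) := fun n => Function.iterate_succ_apply' F n S₀
  have hμ : ∀ n, μ (S n).active ≤ (38 / 39) ^ n * μ Set.univ := fun n => by
    induction n with
    | zero => simp [S, S₀]
    | succ n ih =>
      rw [hS, pow_succ', mul_assoc]
      exact (hFμ _).trans (by gcongr)
  have hanti : Antitone fun n => (S n).active := antitone_nat_of_succ_le fun n => by
    rw [hS]; exact hFsub _
  have hlift : ∀ n v, v ∉ (S n).active → ∀ m, n ≤ m → ∀ i, (S m).lift v i = (S n).lift v i := by
    intro n v hv m hnm i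
    induction m, hnm using Nat.le_induction with
    | base => rfl
    | succ m hnm ih => rw [hS, hFlift _ v (fun h => hv (hanti hnm h)), ih]
  choose s hs using fun n => exists_portSolution (S n).invol
  let t : ℕ → V → Fin 3 := fun n v => (S n).lift v (s n ((S n).target v))
  have ht : ∀ n, PortSolution κ (t n) := fun n => (S n).sol _ (hs n)
  have hlim : ∀ v, ∃ i, ∀ᶠ n in (Filter.hyperfilter ℕ : Filter ℕ), t n v = i := fun v => by
    obtain ⟨i, hi⟩ := Ultrafilter.eq_pure_of_finite ((Filter.hyperfilter ℕ).map fun n => t n v)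
    refine ⟨i, ?_⟩
    have : {i} ∈ (Filter.hyperfilter ℕ).map fun n => t n v := by
      rw [hi]; exact Ultrafilter.mem_pure.2 rfl
    exact this
  choose r hr using hlim
  have hrS : ∀ n v, v ∉ (S n).active → r v = (S n).lift v 0 := fun n v hv => by
    have hev : ∀ᶠ m in (Filter.hyperfilter ℕ : Filter ℕ), n ≤ m :=
      Nat.hyperfilter_le_atTop (Filter.eventually_ge_atTop n)
    obtain ⟨m, hm, hnm⟩ := ((hr v).and hev).exists
    rw [← hm, ← (S n).lift_eq v hv (s m ((S m).target v)) 0]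
    exact hlift n v hv m hnm _
  refine ⟨r, fun v w h => ?_, fun i => ?_⟩
  · obtain ⟨n, hv, hw⟩ := ((hr v).and (hr w)).exists
    rw [← hv, ← hw] at h
    exact ht n v w h
  · have hnull : μ (⋂ n, (S n).active) = 0 := by
      have hlt : (38 / 39 : ENNReal) < 1 :=
        ENNReal.div_lt_of_lt_mul (by norm_num)
      have h0 := ENNReal.Tendsto.mul_const (b := μ Set.univ)
        (ENNReal.tendsto_pow_atTop_nhds_zero_of_lt_one hlt) (Or.inr (measure_ne_top μ _))
      rw [zero_mul] at h0
      exact le_antisymm (ge_of_tendsto' h0 fun n =>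
        (measure_mono (Set.iInter_subset _ n)).trans (hμ n)) zero_le
    have hdecomp : {v | r v = i} = (⋃ n, (S n).activeᶜ ∩ {v | (S n).lift v 0 = i}) ∪
        ({v | r v = i} ∩ ⋂ n, (S n).active) := by
      ext v
      by_cases hv : ∃ n, v ∉ (S n).active
      · obtain ⟨n, hn⟩ := hv
        constructor
        · intro h
          exact Or.inl (Set.mem_iUnion.2 ⟨n, hn, (hrS n v hn).symm.trans h⟩)
        · rintro (h | h)
          · obtain ⟨m, hm, h⟩ := Set.mem_iUnion.1 h
            exact (hrS m v hm).trans h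
          · exact h.1
      · push Not at hv
        simp [hv]
    rw [hdecomp]
    refine NullMeasurableSet.union (MeasurableSet.iUnion fun n =>
      (S n).measurableSet_active.compl.inter
        ((S n).measurable_lift 0 (measurableSet_singleton i))).nullMeasurableSet ?_
    exact NullMeasurableSet.of_null (measure_mono_null Set.inter_subset_right hnull)

/-- A Borel relation with finite sections of bounded size is covered by the graphs of finitely
many Borel functions. -/
lemma exists_measurable_sections {X : Type*} [MeasurableSpace X] [StandardBorelSpace X] (n : ℕ) :
    ∀ R : Set (X × X), MeasurableSet R → (∀ x, {y | (x, y) ∈ R}.encard ≤ n) →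
      ∃ f : Fin n → X → X, (∀ i, Measurable (f i)) ∧
        (∀ x y, (x, y) ∈ R → ∃ i, f i x = y) ∧ ∀ i x, f i x = x ∨ (x, f i x) ∈ R := by
  classical
  obtain ⟨φ, hφ⟩ := exists_measurableEmbedding_real X
  induction n with
  | zero =>
    intro R _ hR
    refine ⟨fun i => i.elim0, fun i => i.elim0, fun x y h => ?_, fun i => i.elim0⟩
    have := hR x
    simp only [Nat.cast_zero, nonpos_iff_eq_zero, Set.encard_eq_zero] at this
    have h' : y ∈ {y | (x, y) ∈ R} := h
    rw [this] at h'
    exact h'.elim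
  | succ n ih =>
    intro R hRm hR
    let P : Set (X × (Fin (n + 1) → X)) :=
      {p | (∀ i, (p.1, p.2 i) ∈ R) ∧ ∀ i j, i < j → φ (p.2 i) < φ (p.2 j)}
    have hev : ∀ i, Measurable fun p : X × (Fin (n + 1) → X) => p.2 i := fun i =>
      (measurable_pi_apply i).comp measurable_snd
    have hP : MeasurableSet P := by
      have : P = (⋂ i, {p | (p.1, p.2 i) ∈ R}) ∩
          ⋂ i, ⋂ j, ⋂ (_ : i < j), {p | φ (p.2 i) < φ (p.2 j)} := by
        ext p; simp [P]
      rw [this]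
      refine (MeasurableSet.iInter fun i => ?_).inter (MeasurableSet.iInter fun i =>
        MeasurableSet.iInter fun j => MeasurableSet.iInter fun _ => ?_)
      · exact (measurable_fst.prodMk (hev i)) hRm
      · exact measurableSet_lt (hφ.measurable.comp (hev i)) (hφ.measurable.comp (hev j))
    have hrange : ∀ p ∈ P, Set.range p.2 = {y | (p.1, y) ∈ R} := fun p hp => by
      have hinj : Function.Injective p.2 := fun i j hij => by
        by_contra hne
        rcases lt_or_gt_of_ne hne with h | h
        · exact (hp.2 _ _ h).ne (by rw [hij])
        · exact (hp.2 _ _ h).ne (by rw [hij])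
      have hsub : Set.range p.2 ⊆ {y | (p.1, y) ∈ R} := by
        rintro _ ⟨i, rfl⟩
        exact hp.1 i
      have hfin : {y | (p.1, y) ∈ R}.Finite :=
        Set.finite_of_encard_le_coe (k := n + 1) (by exact_mod_cast hR p.1)
      refine (Set.finite_range _).eq_of_subset_of_encard_le hsub ((hR p.1).trans ?_)
      rw [← Set.image_univ, hinj.encard_image, Set.encard_univ]
      simp
    have hfst : Set.InjOn Prod.fst P := by
      rintro ⟨x, y⟩ hp ⟨x', y'⟩ hp' (rfl : x = x')
      have h1 : StrictMono (φ ∘ y) := fun i j h => hp.2 i j h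
      have h2 : StrictMono (φ ∘ y') := fun i j h => hp'.2 i j h
      have h3 : Set.range (φ ∘ y) = Set.range (φ ∘ y') := by
        rw [Set.range_comp, Set.range_comp, hrange _ hp, hrange _ hp']
      have h4 := (StrictMono.range_inj h1 h2).1 h3
      rw [hφ.injective.comp_left h4]
    let D : Set X := Prod.fst '' P
    have hD : MeasurableSet D := hP.image_of_measurable_injOn measurable_fst hfst
    have hsel : ∀ x, ∃ y : Fin (n + 1) → X, x ∈ D → (x, y) ∈ P := fun x => by
      by_cases hx : x ∈ D
      · obtain ⟨⟨_, y⟩, hp, rfl⟩ := hx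
        exact ⟨y, fun _ => hp⟩
      · exact ⟨fun _ => x, fun h => absurd h hx⟩
    choose Y hY using hsel
    let f : X → X := fun x => if x ∈ D then Y x 0 else x
    have hf : Measurable f := by
      intro s hs
      have : f ⁻¹' s = Prod.fst '' (P ∩ {p | p.2 0 ∈ s}) ∪ (Dᶜ ∩ s) := by
        ext x
        by_cases hx : x ∈ D
        · simp only [Set.mem_preimage, f, Set.mem_union, Set.mem_inter_iff,
            Set.mem_compl_iff, hx, not_true, false_and, or_false]
          constructor
          · intro h
            exact ⟨(x, Y x), ⟨hY x hx, h⟩, rfl⟩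
          · rintro ⟨p, ⟨hp, hps⟩, rfl⟩
            have : p = (p.1, Y p.1) := hfst hp (hY _ hx) rfl
            have h2 : p.2 = Y p.1 := congrArg Prod.snd this
            rw [← h2]
            exact hps
        · simp only [Set.mem_preimage, f, Set.mem_union, Set.mem_inter_iff,
            Set.mem_compl_iff, hx, not_false_eq_true, true_and]
          refine ⟨Or.inr, ?_⟩
          rintro (⟨p, ⟨hp, -⟩, rfl⟩ | h)
          · exact absurd ⟨p, hp, rfl⟩ hx
          · exact h
      rw [this]
      refine ((hP.inter (hev 0 hs)).image_of_measurable_injOn measurable_fst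
        (hfst.mono Set.inter_subset_left)).union (hD.compl.inter hs)
    have hsmall : ∀ x, x ∉ D → {y | (x, y) ∈ R}.encard ≤ n := fun x hx => by
      by_contra! hlt
      refine hx ?_
      have hfin : {y | (x, y) ∈ R}.Finite :=
        Set.finite_of_encard_le_coe (k := n + 1) (by exact_mod_cast hR x)
      have hcard : (hfin.toFinset.image φ).card = n + 1 := by
        rw [Finset.card_image_of_injective _ hφ.injective]
        have h1 := hR x
        rw [hfin.encard_eq_coe_toFinset_card] at hlt h1
        norm_cast at hlt h1
        omega
      have hmem : ∀ i, ∃ y, (x, y) ∈ R ∧ φ y = (hfin.toFinset.image φ).orderEmbOfFin hcard i := by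
        intro i
        have := Finset.orderEmbOfFin_mem _ hcard i
        obtain ⟨y, hy, h⟩ := Finset.mem_image.1 this
        exact ⟨y, hfin.mem_toFinset.1 hy, h⟩
      choose y hy hφy using hmem
      refine ⟨(x, y), ⟨hy, fun i j hij => ?_⟩, rfl⟩
      rw [hφy, hφy]
      exact ((hfin.toFinset.image φ).orderEmbOfFin hcard).strictMono hij
    obtain ⟨g, hg, hgR, hgx⟩ := ih (R ∩ {p | f p.1 = p.2}ᶜ)
      (hRm.inter (measurableSet_eq_fun (hf.comp measurable_fst) measurable_snd).compl) (by
        intro x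
        by_cases hx : x ∈ D
        · have hfx : f x ∈ {y | (x, y) ∈ R} := by
            simp only [f, if_pos hx]
            exact (hY x hx).1 0
          have : {y | (x, y) ∈ R ∩ {p | f p.1 = p.2}ᶜ} = {y | (x, y) ∈ R} \ {f x} := by
            ext y
            simp [eq_comm]
          rw [this]
          have h := Set.encard_sdiff_singleton_add_one hfx
          have h2 := hR x
          rw [← h] at h2
          push_cast at h2
          exact (ENat.add_le_add_iff_right (by simp)).1 h2
        · exact (Set.encard_le_encard fun y hy => hy.1).trans (hsmall x hx))
    refine ⟨Fin.cons f g, fun i => ?_, fun x y h => ?_, fun i x => ?_⟩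
    · refine Fin.cases hf hg i
    · by_cases hfx : f x = y
      · exact ⟨0, hfx⟩
      · obtain ⟨i, hi⟩ := hgR x y ⟨h, hfx⟩
        exact ⟨i.succ, hi⟩
    · refine Fin.cases ?_ (fun i => ?_) i
      · by_cases hx : x ∈ D
        · right
          simp only [Fin.cons_zero, f, if_pos hx]
          exact (hY x hx).1 0
        · left
          simp [f, hx]
      · exact (hgx i x).imp id fun h => h.1

/-- Let `rep` choose representatives of the classes of an equivalence relation on `M`, let `e` be
an involution of `M`, and let `k x` list three elements of the class of `x` that are either pairwise
distinct or all fixed by `e`. Then up to a null set there is a measurable transversal of the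
classes no two distinct points of which are exchanged by `e`. -/
lemma exists_nullMeasurableSet_transversal {X : Type*} [MeasurableSpace X] [StandardBorelSpace X]
    {M : Set X} (hM : MeasurableSet M) {rep e : X → X} (hrep : Measurable rep) (he : Measurable e)
    {k : X → Fin 3 → X} (hk : ∀ i, Measurable fun x => k x i)
    (hrepM : ∀ x ∈ M, rep x ∈ M) (hrr : ∀ x ∈ M, rep (rep x) = rep x)
    (heM : ∀ x ∈ M, e x ∈ M) (hee : ∀ x ∈ M, e (e x) = x)
    (hkM : ∀ x ∈ M, ∀ i, k x i ∈ M) (hkrep : ∀ x ∈ M, ∀ i, rep (k x i) = rep x)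
    (hkinj : ∀ x ∈ M, Function.Injective (k x) ∨ ∀ i, e (k x i) = k x i)
    (ν : Measure X) [IsFiniteMeasure ν] :
    ∃ T ⊆ M, NullMeasurableSet T ν ∧ (∀ x ∈ M, ∃ y ∈ T, rep y = rep x) ∧
      (∀ y ∈ T, ∀ z ∈ T, rep y = rep z → y = z) ∧ ∀ y ∈ T, e y ∈ T → e y = y := by
  classical
  let y : X × Fin 3 → X := fun p => k p.1 p.2
  have hy : Measurable y := measurable_comp_index (m := fun i (p : X × Fin 3) => k p.1 i)
    (f := Prod.snd) (fun i => (hk i).comp measurable_fst)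
    fun j => measurable_snd (measurableSet_singleton j)
  have hey : Measurable fun p => e (y p) := he.comp hy
  have hrey : Measurable fun p => rep (e (y p)) := hrep.comp hey
  have hQ : ∀ j, MeasurableSet {p | k (rep (e (y p))) j = e (y p)} := fun j =>
    measurableSet_eq_fun ((hk j).comp hrey) hey
  obtain ⟨J, hJ, hJs⟩ := exists_measurable_index _ hQ
  let L : Set (X × Fin 3) := {p | p.1 ∈ M ∧ rep p.1 = p.1 ∧ e (y p) ≠ y p ∧
    ∃ j, k (rep (e (y p))) j = e (y p)}
  have hL : MeasurableSet L := by
    refine (measurable_fst hM).inter ((measurableSet_eq_fun (hrep.comp measurable_fst)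
      measurable_fst).inter ((measurableSet_eq_fun hey hy).compl.inter ?_))
    exact measurableSet_setOfPred.2 (Measurable.exists fun j => measurableSet_setOfPred.1 (hQ j))
  let κ : X × Fin 3 → X × Fin 3 := fun p => if p ∈ L then (rep (e (y p)), J p) else p
  have hκm : Measurable κ := Measurable.ite hL
    (hrey.prodMk (measurable_to_countable' fun j => hJ j)) measurable_id
  have hinj : ∀ x ∈ M, ∀ i j, e (k x i) ≠ k x i → k x i = k x j → i = j := fun x hx i j hne h =>
    (hkinj x hx).elim (fun hi => hi h) fun hi => absurd (hi i) hne
  have hκ : Function.Involutive κ := fun p => by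
    by_cases hp : p ∈ L
    · have hp' := hp
      obtain ⟨hpM, hpr, hpe, hpj⟩ := hp'
      have hyM : y p ∈ M := hkM _ hpM _
      have hj : y (rep (e (y p)), J p) = e (y p) := hJs p hpj
      have hback : e (y (rep (e (y p)), J p)) = y p := by rw [hj, hee _ hyM]
      have hrepy : rep (y p) = p.1 := (hkrep _ hpM _).trans hpr
      have hL' : (rep (e (y p)), J p) ∈ L := by
        refine ⟨hrepM _ (heM _ hyM), hrr _ (heM _ hyM), ?_, ?_⟩
        · rw [hback, hj]
          exact hpe.symm
        · rw [hback, hrepy]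
          exact ⟨p.2, rfl⟩
      simp only [κ, if_pos hp, if_pos hL', hback, hrepy]
      refine Prod.ext rfl (hinj _ hpM _ _ hpe ?_).symm
      have := hJs _ hL'.2.2.2
      rw [hback, hrepy] at this
      exact this.symm
    · simp [κ, hp]
  obtain ⟨s, hs, hsm⟩ := exists_nullMeasurableSet_portSolution hκ hκm (ν.map rep)
  refine ⟨{z | z ∈ M ∧ k (rep z) (s (rep z)) = z}, fun z hz => hz.1, ?_, fun x hx => ?_,
    fun z hz w hw h => ?_, fun z hz hez => ?_⟩
  · have : {z | z ∈ M ∧ k (rep z) (s (rep z)) = z} =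
        M ∩ ⋃ i, rep ⁻¹' {x | s x = i} ∩ {z | k (rep z) i = z} := by
      ext z; simp
    rw [this]
    refine hM.nullMeasurableSet.inter (NullMeasurableSet.iUnion fun i => ?_)
    exact ((hsm i).preimage ⟨hrep, .rfl⟩).inter
      (measurableSet_eq_fun ((hk i).comp hrep) measurable_id).nullMeasurableSet
  · have hr : rep (k (rep x) (s (rep x))) = rep x := (hkrep _ (hrepM x hx) _).trans (hrr x hx)
    refine ⟨k (rep x) (s (rep x)), ⟨hkM _ (hrepM x hx) _, ?_⟩, hr⟩
    rw [hr]
  · rw [← hz.2, ← hw.2, h]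
  · by_contra hne
    have hyz : y (rep z, s (rep z)) = z := hz.2
    have hzL : (rep z, s (rep z)) ∈ L := by
      refine ⟨hrepM z hz.1, hrr z hz.1, ?_, ?_⟩
      · rwa [hyz]
      · rw [hyz]
        exact ⟨_, hez.2⟩
    have hlink : κ (rep z, s (rep z)) = (rep (e z), s (rep (e z))) := by
      simp only [κ, if_pos hzL, hyz]
      refine Prod.ext rfl (hinj _ (hrepM _ hez.1) _ _ ?_ ?_).symm
      · rw [hez.2, hee z hz.1]
        exact fun h => hne h.symm
      · have := hJs _ hzL.2.2.2
        rw [hyz] at this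
        rw [hez.2, this]
    have := hs _ _ hlink
    apply hne
    rw [← hez.2, ← hz.2, hz.2, ← this, hz.2]

namespace SimpleGraph

variable {X : Type*} (G : SimpleGraph X) (d : ℕ)

/-- Two vertices are related if they lie in a common clique with `d` vertices. -/
def CliqueRel (x y : X) : Prop := ∃ s : Finset X, G.IsNClique d s ∧ x ∈ s ∧ y ∈ s

/-- The vertices of `d`-cliques at which the relation `CliqueRel` is transitive. -/
def cliqueCore : Set X :=
  {x | G.CliqueRel d x x ∧ ∀ y z, G.CliqueRel d x y → G.CliqueRel d y z → G.CliqueRel d x z}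

variable {G d}

lemma CliqueRel.symm {x y : X} (h : G.CliqueRel d x y) : G.CliqueRel d y x :=
  let ⟨s, hs, hx, hy⟩ := h
  ⟨s, hs, hy, hx⟩

lemma CliqueRel.adj {x y : X} (h : G.CliqueRel d x y) (hne : x ≠ y) : G.Adj x y :=
  let ⟨_, hs, hx, hy⟩ := h
  hs.isClique hx hy hne

section Degree

variable (hdeg : ∀ x, (G.neighborSet x).encard ≤ (d : ℕ∞))
include hdeg

lemma card_le_of_forall_adj {x : X} {s : Finset X} (hs : ∀ y ∈ s, G.Adj x y) : s.card ≤ d := by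
  have h : (s : Set X).encard ≤ (G.neighborSet x).encard := Set.encard_le_encard hs
  rw [Set.encard_coe_eq_coe_finsetCard] at h
  exact_mod_cast h.trans (hdeg x)

lemma mem_of_adj_of_card_eq {x y : X} {s : Finset X} (hs : ∀ y ∈ s, G.Adj x y) (hd : s.card = d)
    (hy : G.Adj x y) : y ∈ s := by
  classical
  by_contra hys
  have := card_le_of_forall_adj hdeg (x := x) (s := insert y s) (by simpa [hy] using hs)
  rw [Finset.card_insert_of_notMem hys] at this
  omega

lemma IsNClique.le_card_inter [DecidableEq X] {K L : Finset X} (hK : G.IsNClique d K)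
    (hL : G.IsNClique d L) {x : X} (hxK : x ∈ K) (hxL : x ∈ L) : d ≤ (K ∩ L).card + 1 := by
  have h1 := card_le_of_forall_adj hdeg (x := x) (s := (K ∪ L).erase x) fun y hy => by
    obtain ⟨hne, hy⟩ := Finset.mem_erase.1 hy
    rcases Finset.mem_union.1 hy with h | h
    · exact hK.isClique hxK h hne.symm
    · exact hL.isClique hxL h hne.symm
  rw [Finset.card_erase_of_mem (Finset.mem_union_left _ hxK)] at h1
  have h2 := Finset.card_union_add_card_inter K L
  rw [hK.card_eq, hL.card_eq] at h2
  omega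

lemma IsNClique.exists_ne_mem {K L : Finset X} (hd : 3 ≤ d) (hK : G.IsNClique d K)
    (hL : G.IsNClique d L) {x : X} (hxK : x ∈ K) (hxL : x ∈ L) (z : X) :
    ∃ c ∈ K, c ∈ L ∧ c ≠ z := by
  classical
  have h := hK.le_card_inter hdeg hL hxK hxL
  obtain ⟨c, hc, hne⟩ := Finset.exists_mem_ne (s := K ∩ L) (by omega) z
  exact ⟨c, (Finset.mem_inter.1 hc).1, (Finset.mem_inter.1 hc).2, hne⟩

/-- The structure of a graph around a vertex of a `d`-clique where `CliqueRel` is not transitive. -/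
lemma exists_of_notMem_cliqueCore (hd : 3 ≤ d) {z : X} (hz : G.CliqueRel d z z)
    (hzM : z ∉ G.cliqueCore d) :
    ∃ (C : Finset X) (z' : X), ¬ G.CliqueRel d z z' ∧
      (∀ K, G.IsNClique d K → z ∈ K → ∃ c ∈ K, c ∈ C) ∧ (∀ c ∈ C, c ∈ G.cliqueCore d) ∧
      (∀ c ∈ C, ∀ w, G.Adj c w → G.CliqueRel d c w) ∧
      ∀ c ∈ C, ∀ w, G.Adj c w → w ∈ C ∨ w = z ∨ w = z' := by
  classical
  have hzM' : ∃ y z', G.CliqueRel d z y ∧ G.CliqueRel d y z' ∧ ¬ G.CliqueRel d z z' := by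
    by_contra! hcon
    exact hzM ⟨hz, hcon⟩
  obtain ⟨y, z', ⟨L, hL, hzL, hyL⟩, ⟨L', hL', hyL', hmemL'⟩, hzz'⟩ := hzM'
  have hzL' : z ∉ L' := fun h => hzz' ⟨L', hL', h, hmemL'⟩
  have hnotL : z' ∉ L := fun h => hzz' ⟨L, hL, hzL, h⟩
  have hcard := hL.le_card_inter hdeg hL' hyL hyL'
  have hCL : L ∩ L' = L.erase z := Finset.eq_of_subset_of_card_le
    (fun c hc => Finset.mem_erase.2 ⟨fun h => hzL' (h ▸ (Finset.mem_inter.1 hc).2),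
      (Finset.mem_inter.1 hc).1⟩)
    (by rw [Finset.card_erase_of_mem hzL, hL.card_eq]; omega)
  have hCL' : L ∩ L' = L'.erase z' := Finset.eq_of_subset_of_card_le
    (fun c hc => Finset.mem_erase.2 ⟨fun h => hnotL (h ▸ (Finset.mem_inter.1 hc).1),
      (Finset.mem_inter.1 hc).2⟩)
    (by rw [Finset.card_erase_of_mem hmemL', hL'.card_eq]; omega)
  have hnbr : ∀ c ∈ L ∩ L', ∀ w, G.Adj c w → w ∈ L ∨ w ∈ L' := fun c hc w hw => by
    obtain ⟨hcL, hcL'⟩ := Finset.mem_inter.1 hc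
    have := mem_of_adj_of_card_eq hdeg (x := c) (y := w) (s := (insert z' L).erase c)
      (fun v hv => by
        obtain ⟨hne, hv⟩ := Finset.mem_erase.1 hv
        rcases Finset.mem_insert.1 hv with rfl | h
        · exact hL'.isClique hcL' hmemL' hne.symm
        · exact hL.isClique hcL h hne.symm)
      (by
        rw [Finset.card_erase_of_mem (Finset.mem_insert_of_mem hcL),
          Finset.card_insert_of_notMem hnotL, hL.card_eq]
        omega) hw
    rcases Finset.mem_insert.1 (Finset.mem_erase.1 this).2 with rfl | h
    · exact Or.inr hmemL'
    · exact Or.inl h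
  have hrel : ∀ c ∈ L ∩ L', ∀ w, w ∈ L ∨ w ∈ L' → G.CliqueRel d c w := fun c hc w hw =>
    hw.elim (fun h => ⟨L, hL, (Finset.mem_inter.1 hc).1, h⟩)
      fun h => ⟨L', hL', (Finset.mem_inter.1 hc).2, h⟩
  have hmeet : ∀ K, G.IsNClique d K → ∀ v ∈ K, v ∈ L ∨ v ∈ L' → ∃ c ∈ K, c ∈ L ∩ L' := by
    rintro K hK v hv (h | h)
    · obtain ⟨c, hcK, hcL, hne⟩ := hK.exists_ne_mem hdeg hd hL hv h z
      exact ⟨c, hcK, hCL ▸ Finset.mem_erase.2 ⟨hne, hcL⟩⟩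
    · obtain ⟨c, hcK, hcL, hne⟩ := hK.exists_ne_mem hdeg hd hL' hv h z'
      exact ⟨c, hcK, hCL' ▸ Finset.mem_erase.2 ⟨hne, hcL⟩⟩
  have hclosed : ∀ v w, v ∈ L ∨ v ∈ L' → G.CliqueRel d v w → w ∈ L ∨ w ∈ L' := by
    rintro v w hv ⟨K, hK, hvK, hwK⟩
    obtain ⟨c, hcK, hc⟩ := hmeet K hK v hvK hv
    by_cases hcw : c = w
    · exact Or.inl (hcw ▸ (Finset.mem_inter.1 hc).1)
    · exact hnbr c hc w (hK.isClique hcK hwK hcw)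
  refine ⟨L ∩ L', z', hzz', fun K hK hzK => hmeet K hK z hzK (Or.inl hzL), fun c hc => ?_,
    fun c hc w hw => hrel c hc w (hnbr c hc w hw), fun c hc w hw => ?_⟩
  · have hcL : c ∈ L ∨ c ∈ L' := Or.inl (Finset.mem_inter.1 hc).1
    exact ⟨hrel c hc c hcL, fun v w hv hw => hrel c hc w (hclosed v w (hclosed c v hcL hv) hw)⟩
  · by_cases h : w = z ∨ w = z'
    · exact Or.inr h
    · push Not at h
      rcases hnbr c hc w hw with hwL | hwL
      · exact Or.inl (hCL ▸ Finset.mem_erase.2 ⟨h.1, hwL⟩)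
      · exact Or.inl (hCL' ▸ Finset.mem_erase.2 ⟨h.2, hwL⟩)

lemma IsNClique.exists_mem_cliqueCore (hd : 3 ≤ d) {K : Finset X} (hK : G.IsNClique d K) :
    ∃ x ∈ K, x ∈ G.cliqueCore d := by
  obtain ⟨z, hz⟩ : K.Nonempty := Finset.card_pos.1 (by rw [hK.card_eq]; omega)
  by_cases hzM : z ∈ G.cliqueCore d
  · exact ⟨z, hz, hzM⟩
  · obtain ⟨C, z', -, hC, hCM, -, -⟩ := exists_of_notMem_cliqueCore hdeg hd ⟨K, hK, hz, hz⟩ hzM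
    obtain ⟨c, hcK, hc⟩ := hC K hK hz
    exact ⟨c, hcK, hCM c hc⟩

lemma exists_subset_cliqueCore_or (hd : 3 ≤ d) {x : X} (hx : x ∈ G.cliqueCore d) :
    (∃ K, G.IsNClique d K ∧ x ∈ K ∧ ∀ y ∈ K, y ∈ G.cliqueCore d) ∨
      ∀ y, G.Adj x y → G.CliqueRel d x y := by
  obtain ⟨K, hK, hxK, -⟩ := hx.1
  by_cases hKM : ∀ y ∈ K, y ∈ G.cliqueCore d
  · exact Or.inl ⟨K, hK, hxK, hKM⟩
  right
  push Not at hKM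
  obtain ⟨z, hzK, hzM⟩ := hKM
  obtain ⟨C, z', hzz', hC, -, hCrel, hCadj⟩ :=
    exists_of_notMem_cliqueCore hdeg hd ⟨K, hK, hzK, hzK⟩ hzM
  obtain ⟨c, hcK, hc⟩ := hC K hK hzK
  apply hCrel
  by_cases hcx : c = x
  · exact hcx ▸ hc
  rcases hCadj c hc x (hK.isClique hcK hxK hcx) with h | rfl | rfl
  · exact h
  · exact absurd hx hzM
  · exact absurd ⟨K, hK, hzK, hxK⟩ hzz'

lemma eq_of_adj_of_not_cliqueRel {x y z : X} (hx : G.CliqueRel d x x) (hy : G.Adj x y)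
    (hyR : ¬ G.CliqueRel d x y) (hz : G.Adj x z) (hzR : ¬ G.CliqueRel d x z) : y = z := by
  classical
  obtain ⟨K, hK, hxK, -⟩ := hx
  by_contra hne
  have hyK : y ∉ K := fun h => hyR ⟨K, hK, hxK, h⟩
  have hzK : z ∉ K := fun h => hzR ⟨K, hK, hxK, h⟩
  have h := card_le_of_forall_adj hdeg (x := x) (s := insert y (insert z (K.erase x))) (by
    simp only [Finset.mem_insert, Finset.mem_erase]
    rintro w (rfl | rfl | ⟨hw, hwK⟩)
    · exact hy
    · exact hz
    · exact hK.isClique hxK hwK hw.symm)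
  rw [Finset.card_insert_of_notMem (by simp [hne, hyK]),
    Finset.card_insert_of_notMem (by simp [hzK]), Finset.card_erase_of_mem hxK, hK.card_eq] at h
  have := Finset.card_pos.2 ⟨x, hxK⟩
  rw [hK.card_eq] at this
  omega

end Degree

lemma IsNClique.mem_of_cliqueRel (hclique : G.CliqueFree (d + 1)) {K : Finset X}
    (hK : G.IsNClique d K) {x y : X} (hx : x ∈ K) (hy : y ∈ G.cliqueCore d)
    (hxy : G.CliqueRel d x y) : y ∈ K := by
  classical
  by_contra hyK
  refine hclique (insert y K) (hK.insert fun w hw => ?_)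
  exact (hy.2 x w hxy.symm ⟨K, hK, hx, hw⟩).adj fun h => hyK (h ▸ hw)

end SimpleGraph

namespace SimpleGraph

section Measurable

variable {X : Type*} {G : SimpleGraph X} {d : ℕ} {m : Option (Fin d) → X → X}

lemma cliqueRel_iff (hm₀ : m none = id) (hadj : ∀ x y, G.Adj x y → ∃ i, m i x = y) {x y : X} :
    G.CliqueRel d x y ↔ ∃ σ : Fin d → Option (Fin d),
      (∀ i j, i ≠ j → G.Adj (m (σ i) x) (m (σ j) x)) ∧
        (∃ i, m (σ i) x = x) ∧ ∃ i, m (σ i) x = y := by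
  classical
  constructor
  · rintro ⟨s, hs, hx, hy⟩
    have hmem : ∀ z ∈ s, ∃ i, m i x = z := fun z hz => by
      by_cases hxz : x = z
      · exact ⟨none, by rw [hm₀, id, hxz]⟩
      · exact hadj x z (hs.isClique hx hz hxz)
    let ε : Fin d ≃ s := (s.equivFinOfCardEq hs.card_eq).symm
    choose σ hσ using fun i => hmem _ (ε i).2
    refine ⟨σ, fun i j hij => ?_, ⟨ε.symm ⟨x, hx⟩, by rw [hσ]; simp⟩,
      ⟨ε.symm ⟨y, hy⟩, by rw [hσ]; simp⟩⟩
    rw [hσ, hσ]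
    exact hs.isClique (ε i).2 (ε j).2 fun h => hij (ε.injective (Subtype.ext h))
  · rintro ⟨σ, hσ, ⟨i, hi⟩, j, hj⟩
    have hinj : Function.Injective fun i => m (σ i) x := fun i j hij => by
      by_contra hne
      exact (hσ i j hne).ne hij
    refine ⟨Finset.univ.image fun i => m (σ i) x, ⟨?_, ?_⟩, ?_, ?_⟩
    · rintro a ha b hb hab
      simp only [Finset.coe_image, Finset.coe_univ, Set.image_univ, Set.mem_range] at ha hb
      obtain ⟨i, rfl⟩ := ha
      obtain ⟨j, rfl⟩ := hb
      exact hσ i j fun h => hab (by rw [h])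
    · rw [Finset.card_image_of_injective _ hinj]
      simp
    · exact Finset.mem_image.2 ⟨i, Finset.mem_univ _, hi⟩
    · exact Finset.mem_image.2 ⟨j, Finset.mem_univ _, hj⟩

lemma exists_index_of_cliqueRel (hm₀ : m none = id)
    (hadj : ∀ x y, G.Adj x y → ∃ i, m i x = y) {x y : X} (h : G.CliqueRel d x y) :
    ∃ i, m i x = y := by
  by_cases hxy : x = y
  · exact ⟨none, by rw [hm₀, id, hxy]⟩
  · exact hadj x y (h.adj hxy)

variable [MeasurableSpace X] (hG : MeasurableSet {p : X × X | G.Adj p.1 p.2})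
include hG

lemma measurable_adj_comp {α : Type*} [MeasurableSpace α] {f g : α → X} (hf : Measurable f)
    (hg : Measurable g) : Measurable fun a => G.Adj (f a) (g a) :=
  measurableSet_setOfPred.1 ((hf.prodMk hg) hG)

variable [MeasurableEq X] (hm₀ : m none = id) (hadj : ∀ x y, G.Adj x y → ∃ i, m i x = y)
  (hm : ∀ i, Measurable (m i))
include hm₀ hadj hm

lemma measurable_cliqueRel {α : Type*} [MeasurableSpace α] {f g : α → X} (hf : Measurable f)
    (hg : Measurable g) : Measurable fun a => G.CliqueRel d (f a) (g a) := by
  simp only [cliqueRel_iff hm₀ hadj]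
  refine .exists fun σ => .and (.forall fun i => .forall fun j => .imp measurable_const ?_)
    (.and (.exists fun i => ?_) (.exists fun i => ?_))
  · exact measurable_adj_comp hG ((hm _).comp hf) ((hm _).comp hf)
  · exact measurableSet_setOfPred.1 (measurableSet_eq_fun ((hm _).comp hf) hf)
  · exact measurableSet_setOfPred.1 (measurableSet_eq_fun ((hm _).comp hf) hg)

lemma measurableSet_cliqueCore : MeasurableSet (G.cliqueCore d) := by
  have : G.cliqueCore d = {x | G.CliqueRel d x x ∧ ∀ i j, G.CliqueRel d x (m i x) →
      G.CliqueRel d (m i x) (m j (m i x)) → G.CliqueRel d x (m j (m i x))} := by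
    ext x
    refine and_congr_right fun _ => ⟨fun h i j => h _ _, fun h y z hy hz => ?_⟩
    obtain ⟨i, rfl⟩ := exists_index_of_cliqueRel hm₀ hadj hy
    obtain ⟨j, rfl⟩ := exists_index_of_cliqueRel hm₀ hadj hz
    exact h i j hy hz
  rw [this]
  have hR : ∀ {f g : X → X}, Measurable f → Measurable g →
      Measurable fun a => G.CliqueRel d (f a) (g a) :=
    fun hf hg => measurable_cliqueRel hG hm₀ hadj hm hf hg
  exact measurableSet_setOfPred.2 (.and (hR measurable_id measurable_id)
    (.forall fun i => .forall fun j => .imp (hR measurable_id (hm i))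
      (.imp (hR (hm i) ((hm j).comp (hm i))) (hR measurable_id ((hm j).comp (hm i))))))

end Measurable

/-- An independent set meeting every `d`-clique, measurable up to a null set. -/
lemma exists_nullMeasurableSet_meeting_cliques {X : Type*} [MeasurableSpace X]
    [StandardBorelSpace X] {G : SimpleGraph X} (hG : MeasurableSet {p : X × X | G.Adj p.1 p.2})
    {d : ℕ} (hd : 3 ≤ d) (hdeg : ∀ x, (G.neighborSet x).encard ≤ (d : ℕ∞))
    (hclique : G.CliqueFree (d + 1)) {n : Fin d → X → X} (hn : ∀ i, Measurable (n i))
    (hadjn : ∀ x y, G.Adj x y → ∃ i, n i x = y) (ν : Measure X) [IsFiniteMeasure ν] :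
    ∃ T : Set X, NullMeasurableSet T ν ∧ (∀ x ∈ T, ∀ y ∈ T, ¬ G.Adj x y) ∧
      ∀ s : Finset X, G.IsNClique d s → ∃ x ∈ T, x ∈ s := by
  classical
  let m : Option (Fin d) → X → X := fun o => o.elim id n
  have hm₀ : m none = id := rfl
  have hm : ∀ o, Measurable (m o) := fun o => by
    cases o with
    | none => exact measurable_id
    | some i => exact hn i
  have hadj : ∀ x y, G.Adj x y → ∃ o, m o x = y := fun x y h =>
    let ⟨i, hi⟩ := hadjn x y h
    ⟨some i, hi⟩
  obtain ⟨φ, hφ⟩ := exists_measurableEmbedding_real X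
  set M := G.cliqueCore d with hMdef
  have hM : MeasurableSet M := measurableSet_cliqueCore hG hm₀ hadj hm
  have hMp : ∀ {f : X → X}, Measurable f → Measurable fun x => f x ∈ M := fun hf =>
    measurableSet_setOfPred.1 (hf hM)
  have hR : ∀ {f g : X → X}, Measurable f → Measurable g →
      Measurable fun a => G.CliqueRel d (f a) (g a) :=
    fun hf hg => measurable_cliqueRel hG hm₀ hadj hm hf hg
  have hRm : ∀ x y, G.CliqueRel d x y → ∃ o, m o x = y := fun x y h =>
    exists_index_of_cliqueRel hm₀ hadj h
  let Qe : X → Option (Fin d) → Prop := fun x o =>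
    x ∈ M ∧ m o x ∈ M ∧ G.Adj x (m o x) ∧ ¬ G.CliqueRel d x (m o x)
  have hQe : ∀ o, MeasurableSet {x | Qe x o} := fun o => measurableSet_setOfPred.2
    (.and (hMp measurable_id) (.and (hMp (hm o)) (.and (measurable_adj_comp hG measurable_id (hm o))
      (.not (hR measurable_id (hm o))))))
  obtain ⟨σe, hσe, hσe'⟩ := exists_measurable_index Qe hQe
  let e : X → X := fun x => if ∃ o, Qe x o then m (σe x) x else x
  have he : Measurable e := Measurable.ite
    (measurableSet_setOfPred.2 (.exists fun o => measurableSet_setOfPred.1 (hQe o)))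
    (measurable_comp_index hm hσe) measurable_id
  have heq : ∀ x ∈ M, ∀ y ∈ M, G.Adj x y → ¬ G.CliqueRel d x y → e x = y := by
    intro x hx y hy hxy hnR
    obtain ⟨o, rfl⟩ := hadj x y hxy
    have hex : ∃ o, Qe x o := ⟨o, hx, hy, hxy, hnR⟩
    have h := hσe' x hex
    simp only [e, if_pos hex]
    exact eq_of_adj_of_not_cliqueRel hdeg hx.1 h.2.2.1 h.2.2.2 hxy hnR
  have hecases : ∀ x, e x = x ∨
      (x ∈ M ∧ e x ∈ M ∧ G.Adj x (e x) ∧ ¬ G.CliqueRel d x (e x)) := fun x => by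
    by_cases hex : ∃ o, Qe x o
    · right
      simp only [e, if_pos hex]
      exact hσe' x hex
    · left
      simp [e, hex]
  have heM : ∀ x ∈ M, e x ∈ M := fun x hx => (hecases x).elim (fun h => h.symm ▸ hx) fun h => h.2.1
  have hee : ∀ x ∈ M, e (e x) = x := fun x hx => (hecases x).elim (fun h => by rw [h, h])
    fun h => heq _ h.2.1 _ hx h.2.2.1.symm fun h' => h.2.2.2 h'.symm
  let Qr : X → Option (Fin d) → Prop := fun x o => (m o x ∈ M ∧ G.CliqueRel d x (m o x)) ∧
    ∀ o', m o' x ∈ M → G.CliqueRel d x (m o' x) → φ (m o x) ≤ φ (m o' x)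
  have hQr : ∀ o, MeasurableSet {x | Qr x o} := fun o => measurableSet_setOfPred.2
    (.and (.and (hMp (hm o)) (hR measurable_id (hm o)))
      (.forall fun o' => .imp (hMp (hm o')) (.imp (hR measurable_id (hm o'))
        (measurableSet_setOfPred.1 (measurableSet_le (hφ.measurable.comp (hm o))
          (hφ.measurable.comp (hm o')))))))
  obtain ⟨σr, hσr, hσr'⟩ := exists_measurable_index Qr hQr
  let rep : X → X := fun x => m (σr x) x
  have hrep : Measurable rep := measurable_comp_index hm hσr
  have hreps : ∀ x ∈ M, (rep x ∈ M ∧ G.CliqueRel d x (rep x)) ∧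
      ∀ y ∈ M, G.CliqueRel d x y → φ (rep x) ≤ φ y := fun x hx => by
    have hex : ∃ o, Qr x o := by
      obtain ⟨o, ho, hmin⟩ := Finset.exists_min_image
        (Finset.univ.filter fun o => m o x ∈ M ∧ G.CliqueRel d x (m o x)) (fun o => φ (m o x))
        ⟨none, by simpa [m] using ⟨hx, hx.1⟩⟩
      refine ⟨o, (Finset.mem_filter.1 ho).2, fun o' h h' => hmin o' ?_⟩
      exact Finset.mem_filter.2 ⟨Finset.mem_univ _, h, h'⟩
    refine ⟨(hσr' x hex).1, fun y hy hxy => ?_⟩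
    obtain ⟨o, rfl⟩ := hRm x y hxy
    exact (hσr' x hex).2 o hy hxy
  have hrepeq : ∀ x ∈ M, ∀ y ∈ M, G.CliqueRel d x y → rep x = rep y := fun x hx y hy h => by
    obtain ⟨⟨h1, h2⟩, h3⟩ := hreps x hx
    obtain ⟨⟨h4, h5⟩, h6⟩ := hreps y hy
    exact hφ.injective (le_antisymm (h3 _ h4 (hx.2 _ _ h h5)) (h6 _ h1 (hy.2 _ _ h.symm h2)))
  have hrel : ∀ x ∈ M, ∀ y ∈ M, rep x = rep y → G.CliqueRel d x y := fun x hx y hy h =>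
    hx.2 _ _ (hreps x hx).1.2 (h ▸ (hreps y hy).1.2.symm)
  let Qk : X → (Fin 3 → Option (Fin d)) → Prop := fun x τ =>
    (∀ i, m (τ i) x ∈ M ∧ G.CliqueRel d x (m (τ i) x)) ∧
      ((∀ i j, i ≠ j → ¬ m (τ i) x = m (τ j) x) ∨ ∀ i, e (m (τ i) x) = m (τ i) x)
  have hQk : ∀ τ, MeasurableSet {x | Qk x τ} := fun τ => measurableSet_setOfPred.2
    (.and (.forall fun i => .and (hMp (hm _)) (hR measurable_id (hm _)))
      (.or (.forall fun i => .forall fun j => .imp measurable_const (.not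
          (measurableSet_setOfPred.1 (measurableSet_eq_fun (hm _) (hm _)))))
        (.forall fun i =>
          measurableSet_setOfPred.1 (measurableSet_eq_fun (he.comp (hm _)) (hm _)))))
  obtain ⟨σk, hσk, hσk'⟩ := exists_measurable_index Qk hQk
  let k : X → Fin 3 → X := fun x i => m (σk x i) x
  have hk : ∀ i, Measurable fun x => k x i := fun i =>
    measurable_comp_index (m := fun (τ : Fin 3 → Option (Fin d)) x => m (τ i) x)
      (fun τ => hm _) hσk
  have hks : ∀ x ∈ M, (∀ i, k x i ∈ M ∧ G.CliqueRel d x (k x i)) ∧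
      ((∀ i j, i ≠ j → ¬ k x i = k x j) ∨ ∀ i, e (k x i) = k x i) := fun x hx => by
    refine hσk' x ?_
    rcases exists_subset_cliqueCore_or hdeg hd hx with ⟨K, hK, hxK, hKM⟩ | hall
    · let ε : Fin d ≃ K := (K.equivFinOfCardEq hK.card_eq).symm
      choose τ hτ using fun i : Fin 3 => hRm x (ε (Fin.castLE hd i)) ⟨K, hK, hxK, (ε _).2⟩
      refine ⟨τ, fun i => ?_, Or.inl fun i j hij h => ?_⟩
      · rw [hτ]
        exact ⟨hKM _ (ε _).2, K, hK, hxK, (ε _).2⟩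
      · rw [hτ, hτ] at h
        exact hij (Fin.castLE_injective hd (ε.injective (Subtype.ext h)))
    · refine ⟨fun _ => none, fun i => ⟨hx, hx.1⟩, Or.inr fun i => ?_⟩
      exact (hecases x).elim id fun h => absurd (hall _ h.2.2.1) h.2.2.2
  obtain ⟨T, hTM, hT, hTrep, hTuniq, hTe⟩ := exists_nullMeasurableSet_transversal hM hrep he hk
    (fun x hx => (hreps x hx).1.1)
    (fun x hx => (hrepeq x hx _ (hreps x hx).1.1 (hreps x hx).1.2).symm) heM hee
    (fun x hx i => ((hks x hx).1 i).1)
    (fun x hx i => (hrepeq x hx _ ((hks x hx).1 i).1 ((hks x hx).1 i).2).symm)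
    (fun x hx => (hks x hx).2.imp_left fun h i j hij => by
      by_contra hne
      exact h i j hne hij) ν
  refine ⟨T, hT, fun x hx y hy hxy => ?_, fun s hs => ?_⟩
  · by_cases h : G.CliqueRel d x y
    · exact hxy.ne (hTuniq x hx y hy (hrepeq x (hTM hx) y (hTM hy) h))
    · have hexy := heq x (hTM hx) y (hTM hy) hxy h
      have := hTe x hx (hexy ▸ hy)
      exact hxy.ne (this.symm.trans hexy)
  · obtain ⟨x, hxs, hxM⟩ := hs.exists_mem_cliqueCore hdeg hd
    obtain ⟨y, hy, hyx⟩ := hTrep x hxM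
    exact ⟨y, hy, hs.mem_of_cliqueRel hclique hxs (hTM hy) (hrel x hxM y (hTM hy) hyx.symm)⟩

/-- A null-measurable independent set extends to a null-measurable maximal independent set. -/
lemma exists_nullMeasurableSet_maximal_independent {X I : Type*} [MeasurableSpace X]
    [MeasurableSpace.CountablySeparated X] [Finite I] {G : SimpleGraph X} {n : I → X → X}
    (hn : ∀ i, Measurable (n i)) (hadj : ∀ x y, G.Adj x y → ∃ i, n i x = y)
    (hnG : ∀ i x, n i x = x ∨ G.Adj x (n i x)) {ν : Measure X}
    (hν : ∀ i, Measure.QuasiMeasurePreserving (n i) ν ν) {T : Set X} (hT : NullMeasurableSet T ν)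
    (hind : ∀ x ∈ T, ∀ y ∈ T, ¬ G.Adj x y) :
    ∃ A : Set X, T ⊆ A ∧ NullMeasurableSet A ν ∧ (∀ x ∈ A, ∀ y ∈ A, ¬ G.Adj x y) ∧
      ∀ x, x ∉ A → ∃ y ∈ A, G.Adj x y := by
  obtain ⟨c, hc, hcne⟩ := exists_measurable_nat_coloring_s19 n hn
  let A : ℕ → Set X := fun k => Nat.rec T
    (fun k B => B ∪ {x | c x = k ∧ x ∉ B ∧ ∀ i, n i x ∉ B}) k
  have hA : ∀ k, A (k + 1) = A k ∪ {x | c x = k ∧ x ∉ A k ∧ ∀ i, n i x ∉ A k} := fun _ => rfl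
  have hmono : Monotone A := monotone_nat_of_le_succ fun k => by
    rw [hA]
    exact Set.subset_union_left
  have hAm : ∀ k, NullMeasurableSet (A k) ν := fun k => by
    induction k with
    | zero => exact hT
    | succ k ih =>
      rw [hA]
      have : {x | c x = k ∧ x ∉ A k ∧ ∀ i, n i x ∉ A k} =
          c ⁻¹' {k} ∩ ((A k)ᶜ ∩ ⋂ i, n i ⁻¹' (A k)ᶜ) := by
        ext x; simp
      rw [this]
      exact ih.union ((hc (measurableSet_singleton k)).nullMeasurableSet.inter
        (ih.compl.inter (NullMeasurableSet.iInter fun i => ih.compl.preimage (hν i))))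
  have hAind : ∀ k, ∀ x ∈ A k, ∀ y ∈ A k, ¬ G.Adj x y := fun k => by
    induction k with
    | zero => exact hind
    | succ k ih =>
      intro x hx y hy hxy
      rw [hA] at hx hy
      rcases hx with hx | ⟨hcx, -, hx⟩ <;> rcases hy with hy | ⟨hcy, -, hy⟩
      · exact ih x hx y hy hxy
      · obtain ⟨i, rfl⟩ := hadj y x hxy.symm
        exact hy i hx
      · obtain ⟨i, rfl⟩ := hadj x y hxy
        exact hx i hy
      · obtain ⟨i, rfl⟩ := hadj x y hxy
        exact hcne i x hxy.ne' (hcy.trans hcx.symm)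
  refine ⟨⋃ k, A k, Set.subset_iUnion A 0, .iUnion hAm, fun x hx y hy => ?_, fun x hx => ?_⟩
  · obtain ⟨k, hk⟩ := Set.mem_iUnion.1 hx
    obtain ⟨l, hl⟩ := Set.mem_iUnion.1 hy
    exact hAind (max k l) x (hmono (le_max_left k l) hk) y (hmono (le_max_right k l) hl)
  · by_contra! hcon
    have hxA : ∀ k, x ∉ A k := fun k h => hx (Set.mem_iUnion.2 ⟨k, h⟩)
    refine hxA (c x + 1) ?_
    rw [hA]
    refine Or.inr ⟨rfl, hxA _, fun i hi => ?_⟩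
    rcases hnG i x with h | h
    · exact hxA _ (h ▸ hi)
    · exact hcon _ (Set.mem_iUnion.2 ⟨_, hi⟩) h

end SimpleGraph

theorem stmt_19 {X : Type*} [MeasurableSpace X] [StandardBorelSpace X]
    (G : SimpleGraph X) (hGmeas : MeasurableSet {p : X × X | G.Adj p.1 p.2})
    (d : ℕ) (hd : 3 ≤ d)
    (hdeg : ∀ x : X, (G.neighborSet x).encard ≤ (d : ℕ∞))
    (hclique : G.CliqueFree (d + 1))
    (μ : Measure X) [IsProbabilityMeasure μ] :
    ∃ A : Set X, NullMeasurableSet A μ ∧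
      (∀ x ∈ A, ∀ y ∈ A, ¬ G.Adj x y) ∧
      (∀ x : X, x ∉ A → ∃ y ∈ A, G.Adj x y) ∧
      ∀ s : Finset X, G.IsNClique d s → ∃ x ∈ A, x ∈ s := by
  obtain ⟨n, hn, hadj, hnG⟩ := exists_measurable_sections d _ hGmeas hdeg
  obtain ⟨ν, _, hμν, hν⟩ := exists_quasiMeasurePreserving n hn μ
  obtain ⟨T, hT, hTind, hTcl⟩ := SimpleGraph.exists_nullMeasurableSet_meeting_cliques hGmeas hd
    hdeg hclique hn hadj ν
  obtain ⟨A, hTA, hA, hAind, hAmax⟩ := SimpleGraph.exists_nullMeasurableSet_maximal_independent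
    hn hadj hnG hν hT hTind
  refine ⟨A, hA.mono_ac hμν, hAind, hAmax, fun s hs => ?_⟩
  obtain ⟨x, hx, hxs⟩ := hTcl s hs
  exact ⟨x, hTA hx, hxs⟩
end
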